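/- arXiv:1406.0042 — 3 statements merged into one kernel-verified Lean document; each statement's English description precedes it below -/
import Mathlib

section
/- Let 0 < R ≤ ∞, let I = [0,R) or I = (-R,R), and let f : I → ℝ. Fix an integer n ≥ 2. Suppose f admits at least n−1 nonzero derivatives at 0, of orders 0 ≤ m_1 < ⋯ < m_{n−1} (i.e., f is m_{n−1} times differentiable at 0, derivatives taken within I, with f^{(m_i)}(0) ≠ 0 for i = 1,…,n−1 and f^{(m)}(0) = 0 for every other m < m_{n−1}). If f[A] ∈ P_n for every A ∈ P_n^1(I), then f^{(m_i)}(0) > 0 for all i = 1,…,n−1, and f(x) ≥ Σ_{i=1}^{n−1} (f^{(m_i)}(0)/m_i!) x^{m_i} for every x ∈ I with x ≥ 0. -/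
open Matrix Set
open Filter Topology Asymptotics

theorem aux_vander {N : ℕ} (m : Fin N → ℕ) (hm : StrictMono m) :
    ∃ W : Fin N → Fin N → ℝ, ∀ k l, ∑ j, W j k * ((2:ℝ) ^ (j:ℕ)) ^ m l = if l = k then 1 else 0 := by
  set V : Matrix (Fin N) (Fin N) ℝ := vandermonde (fun i => (2:ℝ) ^ m i) with hV
  have hinj : Function.Injective (fun i => (2:ℝ) ^ m i) := by
    intro a b h
    exact hm.injective (pow_right_injective₀ (by norm_num : (0:ℝ) < 2) (by norm_num) h)
  have hdet : IsUnit V.det := (det_vandermonde_ne_zero_iff.2 hinj).isUnit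
  have hmul := V.mul_nonsing_inv hdet
  refine ⟨fun j k => V⁻¹ j k, fun k l => ?_⟩
  have h := congrFun (congrFun hmul l) k
  rw [Matrix.mul_apply, Matrix.one_apply] at h
  rw [← h]
  refine Finset.sum_congr rfl fun j _ => ?_
  simp only [hV, vandermonde_apply]
  rw [← pow_mul, ← pow_mul, mul_comm (j:ℕ)]
  ring

theorem aux_quad {n : ℕ} {I : Set ℝ} {f : ℝ → ℝ}
    (hmap : ∀ A : Matrix (Fin n) (Fin n) ℝ, A.PosSemidef → A.rank ≤ 1 →
      (∀ i j, A i j ∈ I) → (A.map f).PosSemidef)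
    (u v : Fin n → ℝ) (hu : ∀ i j, u i * u j ∈ I) :
    0 ≤ ∑ i, ∑ j, v i * v j * f (u i * u j) := by
  have h1 : (vecMulVec u u).PosSemidef := by
    simpa using posSemidef_vecMulVec_self_star u
  have h := (hmap (vecMulVec u u) h1 (rank_vecMulVec_le u u)
    (fun i j => by simpa [vecMulVec_apply] using hu i j)).dotProduct_mulVec_nonneg v
  simp only [dotProduct, mulVec, Matrix.map_apply, vecMulVec_apply, Finset.mul_sum,
    star_trivial] at h
  refine h.trans_eq (Finset.sum_congr rfl fun i _ => Finset.sum_congr rfl fun j _ => ?_)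
  ring

theorem aux_quad2 {n N : ℕ} {I : Set ℝ} {f r : ℝ → ℝ} {c : Fin N → ℝ} {m : Fin N → ℕ}
    (hf : ∀ x, f x = ∑ k, c k * x ^ m k + r x)
    (hmap : ∀ A : Matrix (Fin n) (Fin n) ℝ, A.PosSemidef → A.rank ≤ 1 →
      (∀ i j, A i j ∈ I) → (A.map f).PosSemidef)
    (u v : Fin n → ℝ) (hu : ∀ i j, u i * u j ∈ I) :
    0 ≤ ∑ k, c k * (∑ i, v i * u i ^ m k) ^ 2 + ∑ i, ∑ j, v i * v j * r (u i * u j) := by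
  have h := aux_quad hmap u v hu
  convert h using 1
  simp only [hf, mul_add, Finset.sum_add_distrib, Finset.mul_sum]
  congr 1
  rw [Finset.sum_congr rfl (fun i _ => Finset.sum_comm), Finset.sum_comm]
  refine Finset.sum_congr rfl fun k _ => ?_
  rw [sq, Finset.sum_mul_sum, Finset.mul_sum]
  refine Finset.sum_congr rfl fun i _ => ?_
  rw [Finset.mul_sum]
  refine Finset.sum_congr rfl fun j _ => ?_
  rw [mul_pow]; ring

theorem aux_quad3 {n N : ℕ} {I : Set ℝ} {f r : ℝ → ℝ} {c : Fin N → ℝ} {m : Fin N → ℕ}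
    (hf : ∀ x, f x = ∑ k, c k * x ^ m k + r x)
    (hmap : ∀ A : Matrix (Fin (n+1)) (Fin (n+1)) ℝ, A.PosSemidef → A.rank ≤ 1 →
      (∀ i j, A i j ∈ I) → (A.map f).PosSemidef)
    (y e : ℝ) (a w : Fin n → ℝ) (h0 : y * y ∈ I) (h1 : ∀ j, y * a j ∈ I)
    (h2 : ∀ i j, a i * a j ∈ I) :
    0 ≤ ∑ k, c k * (e * y ^ m k + ∑ j, w j * a j ^ m k) ^ 2 +
      (e * e * r (y * y) + 2 * e * ∑ j, w j * r (y * a j) +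
        ∑ i, ∑ j, w i * w j * r (a i * a j)) := by
  have h := aux_quad2 hf hmap (Fin.cons y a) (Fin.cons e w) (by
    intro i j
    refine Fin.cases ?_ (fun i => ?_) i <;> refine Fin.cases ?_ (fun j => ?_) j
    · simpa using h0
    · simpa using h1 j
    · simpa [mul_comm] using h1 i
    · simpa using h2 i j)
  simp only [Fin.sum_univ_succ, Fin.cons_zero, Fin.cons_succ, Finset.sum_add_distrib] at h
  convert h using 2
  rw [mul_assoc 2 e, Finset.mul_sum, two_mul]
  have e1 : ∑ j, e * w j * r (y * a j) = ∑ j, e * (w j * r (y * a j)) :=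
    Finset.sum_congr rfl fun j _ => by ring
  have e2 : ∑ j, w j * e * r (a j * y) = ∑ j, e * (w j * r (y * a j)) :=
    Finset.sum_congr rfl fun j _ => by rw [mul_comm (a j)]; ring
  rw [e1, e2]; ring

theorem aux_tend {I : Set ℝ} {r : ℝ → ℝ} {M : ℕ} {δ : ℝ} (hδ : 0 < δ) (hI : Ico 0 δ ⊆ I)
    (hr : r =o[𝓝[I] 0] fun x => x ^ M) (b : ℝ) (hb : 0 ≤ b) (q k : ℕ) (hq : q ≠ 0)
    (hk : k ≤ q * M) :
    Tendsto (fun t => r (b * t ^ q) / t ^ k) (𝓝[>] 0) (𝓝 0) ∧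
      ∀ᶠ t in 𝓝[>] (0:ℝ), b * t ^ q ∈ I := by
  have hc : Tendsto (fun t : ℝ => b * t ^ q) (𝓝[>] 0) (𝓝 0) := by
    have : Continuous (fun t : ℝ => b * t ^ q) := by fun_prop
    have h := this.tendsto 0
    simp only [zero_pow hq, mul_zero] at h
    exact h.mono_left nhdsWithin_le_nhds
  have hev : ∀ᶠ t in 𝓝[>] (0:ℝ), b * t ^ q ∈ I := by
    filter_upwards [hc.eventually_lt_const hδ, self_mem_nhdsWithin] with t ht ht0
    have ht0' : 0 < t := ht0
    exact hI ⟨by positivity, ht⟩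
  refine ⟨?_, hev⟩
  have h1 := hr.comp_tendsto (tendsto_nhdsWithin_iff.2 ⟨hc, hev⟩)
  have h2 : ((fun x : ℝ => x ^ M) ∘ fun t => b * t ^ q) =O[𝓝[>] 0] fun t => t ^ k := by
    refine IsBigO.of_bound (b ^ M) ?_
    filter_upwards [Ioo_mem_nhdsGT (zero_lt_one : (0:ℝ) < 1)] with t ht
    have ht0 := ht.1
    simp only [Function.comp, mul_pow, ← pow_mul, norm_mul, norm_pow, Real.norm_eq_abs,
      abs_of_nonneg hb, abs_of_pos ht0]
    exact mul_le_mul_of_nonneg_left (pow_le_pow_of_le_one ht0.le ht.2.le hk) (by positivity)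
  exact (h1.trans_isBigO h2).tendsto_div_nhds_zero

theorem aux_core {N : ℕ} {I : Set ℝ} {f r : ℝ → ℝ} {c : Fin N → ℝ} {m : Fin N → ℕ}
    {M : ℕ} {δ : ℝ} (hδ : 0 < δ) (hI : Ico 0 δ ⊆ I) (hm : StrictMono m) (hM : ∀ i, m i ≤ M)
    (hr : r =o[𝓝[I] 0] fun x => x ^ M)
    (hf : ∀ x, f x = ∑ k, c k * x ^ m k + r x)
    (hmap : ∀ A : Matrix (Fin (N+1)) (Fin (N+1)) ℝ, A.PosSemidef → A.rank ≤ 1 →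
      (∀ i j, A i j ∈ I) → (A.map f).PosSemidef) :
    (∀ i, 0 ≤ c i) ∧ ∀ x ∈ I, 0 ≤ x → ∑ k, c k * x ^ m k ≤ f x := by
  obtain ⟨W, hW⟩ := aux_vander m hm
  have hI0 : (0:ℝ) ∈ I := hI ⟨le_rfl, hδ⟩
  have hev2 : ∀ᶠ t in 𝓝[>] (0:ℝ), ∀ i j : Fin N,
      (2:ℝ) ^ (i:ℕ) * 2 ^ (j:ℕ) * t ^ 2 ∈ I := by
    rw [eventually_all]; intro i; rw [eventually_all]; intro j
    exact (aux_tend hδ hI hr ((2:ℝ) ^ (i:ℕ) * 2 ^ (j:ℕ)) (by positivity) 2 0 (by norm_num)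
      (by omega)).2
  constructor
  · intro i
    have hlim : Tendsto (fun t : ℝ => c i + ∑ j, ∑ l, W j i * W l i *
        (r ((2:ℝ) ^ (j:ℕ) * 2 ^ (l:ℕ) * t ^ 2) / t ^ (2 * m i))) (𝓝[>] 0) (𝓝 (c i)) := by
      have : Tendsto (fun t : ℝ => c i + ∑ j, ∑ l, W j i * W l i *
        (r ((2:ℝ) ^ (j:ℕ) * 2 ^ (l:ℕ) * t ^ 2) / t ^ (2 * m i))) (𝓝[>] 0)
          (𝓝 (c i + ∑ j, ∑ l, W j i * W l i * 0)) := by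
        refine tendsto_const_nhds.add (tendsto_finsetSum _ fun j _ => tendsto_finsetSum _ fun l _ =>
          tendsto_const_nhds.mul ?_)
        exact (aux_tend hδ hI hr _ (by positivity) 2 _ (by norm_num)
          (Nat.mul_le_mul_left 2 (hM i))).1
      simpa using this
    refine ge_of_tendsto hlim ?_
    filter_upwards [hev2, self_mem_nhdsWithin] with t ht ht0
    have ht0' : 0 < t := ht0
    have h := aux_quad3 hf hmap 0 0 (fun j => (2:ℝ) ^ (j:ℕ) * t) (fun j => W j i)
      (by simpa using hI0) (fun j => by simpa using hI0)
      (fun j l => by convert ht j l using 1; ring)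
    have e1 : ∀ k, ∑ j : Fin N, W j i * ((2:ℝ) ^ (j:ℕ) * t) ^ m k
        = if k = i then t ^ m k else 0 := by
      intro k
      have := hW i k
      rw [show ∑ j : Fin N, W j i * ((2:ℝ) ^ (j:ℕ) * t) ^ m k
        = (∑ j : Fin N, W j i * ((2:ℝ) ^ (j:ℕ)) ^ m k) * t ^ m k by
          rw [Finset.sum_mul]; exact Finset.sum_congr rfl fun j _ => by rw [mul_pow]; ring, this]
      split_ifs <;> simp
    simp only [e1, zero_mul, mul_zero, zero_add, ite_pow, mul_ite, ne_eq, OfNat.ofNat_ne_zero,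
      not_false_eq_true, zero_pow, Finset.sum_ite_eq', Finset.mem_univ, if_true] at h
    have h' := div_nonneg h (by positivity : 0 ≤ t ^ (2 * m i))
    convert h' using 1
    rw [add_div, Finset.sum_div]
    congr 1
    · rw [← pow_mul, mul_comm (m i) 2, mul_div_assoc, div_self (by positivity), mul_one]
    · refine Finset.sum_congr rfl fun j _ => ?_
      rw [Finset.sum_div]
      refine Finset.sum_congr rfl fun l _ => ?_
      rw [mul_div_assoc]
      congr 3; ring
  · intro x hx hx0
    obtain ⟨y, hy0, rfl⟩ : ∃ y : ℝ, 0 ≤ y ∧ x = y * y :=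
      ⟨√x, Real.sqrt_nonneg x, (Real.mul_self_sqrt hx0).symm⟩
    rw [hf (y * y)]
    suffices 0 ≤ r (y * y) by linarith
    set d : Fin N → Fin N → ℝ := fun j k => -(W j k * y ^ m k) with hd
    have hlim : Tendsto (fun t : ℝ => r (y * y) +
        2 * ∑ j : Fin N, ∑ k, d j k * (r (y * 2 ^ (j:ℕ) * t ^ 1) / t ^ m k) +
        ∑ j : Fin N, ∑ l : Fin N, ∑ k, ∑ p, d j k * d l p *
        (r ((2:ℝ) ^ (j:ℕ) * 2 ^ (l:ℕ) * t ^ 2) / t ^ (m k + m p))) (𝓝[>] 0)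
        (𝓝 (r (y * y) + 2 * ∑ j : Fin N, ∑ k, d j k * 0 +
          ∑ j : Fin N, ∑ l : Fin N, ∑ k, ∑ p, d j k * d l p * 0)) := by
      refine (tendsto_const_nhds.add (tendsto_const_nhds.mul
        (tendsto_finsetSum _ fun j _ => tendsto_finsetSum _ fun k _ =>
          tendsto_const_nhds.mul ?_))).add
        (tendsto_finsetSum _ fun j _ => tendsto_finsetSum _ fun l _ =>
          tendsto_finsetSum _ fun k _ => tendsto_finsetSum _ fun p _ =>
          tendsto_const_nhds.mul ?_)
      · exact (aux_tend hδ hI hr _ (by positivity) 1 _ (by norm_num)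
          (by have := hM k; omega)).1
      · exact (aux_tend hδ hI hr _ (by positivity) 2 _ (by norm_num)
          (by have := hM k; have := hM p; omega)).1
    simp only [mul_zero, Finset.sum_const_zero, add_zero] at hlim
    refine ge_of_tendsto hlim ?_
    have hev1 : ∀ᶠ t in 𝓝[>] (0:ℝ), ∀ j : Fin N, y * (2:ℝ) ^ (j:ℕ) * t ^ 1 ∈ I := by
      rw [eventually_all]; intro j
      exact (aux_tend hδ hI hr (y * (2:ℝ) ^ (j:ℕ)) (by positivity) 1 0 (by norm_num)
        (by omega)).2
    filter_upwards [hev1, hev2, self_mem_nhdsWithin] with t ht1 ht ht0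
    have ht0' : 0 < t := ht0
    have h := aux_quad3 hf hmap y 1 (fun j => (2:ℝ) ^ (j:ℕ) * t) (fun j => ∑ k, d j k / t ^ m k)
      hx (fun j => by convert ht1 j using 1; ring)
      (fun j l => by convert ht j l using 1; ring)
    have e1 : ∀ k, 1 * y ^ m k + ∑ j : Fin N, (∑ p, d j p / t ^ m p) * ((2:ℝ) ^ (j:ℕ) * t) ^ m k
        = 0 := by
      intro k
      have : ∑ j : Fin N, (∑ p, d j p / t ^ m p) * ((2:ℝ) ^ (j:ℕ) * t) ^ m k
        = ∑ p, (-(y ^ m p) / t ^ m p * t ^ m k) * ∑ j : Fin N, W j p * ((2:ℝ) ^ (j:ℕ)) ^ m k := by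
        simp only [Finset.sum_mul, Finset.mul_sum]
        rw [Finset.sum_comm]
        refine Finset.sum_congr rfl fun p _ => Finset.sum_congr rfl fun j _ => ?_
        rw [mul_pow]; simp only [hd]; ring
      rw [this]
      simp only [hW, mul_ite, mul_one, mul_zero, Finset.sum_ite_eq, Finset.mem_univ, if_true]
      rw [div_mul_cancel₀ _ (by positivity)]; ring
    simp only [e1] at h
    simp only [one_mul, mul_one, ne_eq, OfNat.ofNat_ne_zero,
      not_false_eq_true, zero_pow, mul_zero, Finset.sum_const_zero, zero_add] at h
    refine h.trans_eq (Eq.symm ?_)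
    refine congrArg₂ (· + ·) (congrArg (fun z => r (y * y) + 2 * z) ?_) ?_
    · refine Finset.sum_congr rfl fun j _ => ?_
      rw [Finset.sum_mul]
      refine Finset.sum_congr rfl fun k _ => ?_
      rw [show y * 2 ^ (j:ℕ) * t ^ 1 = y * (2 ^ (j:ℕ) * t) by ring]
      ring
    · refine Finset.sum_congr rfl fun j _ => Finset.sum_congr rfl fun l _ => ?_
      rw [Finset.sum_mul_sum, Finset.sum_mul]
      refine Finset.sum_congr rfl fun k _ => ?_
      rw [Finset.sum_mul]
      refine Finset.sum_congr rfl fun p _ => ?_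
      rw [show (2:ℝ) ^ (j:ℕ) * 2 ^ (l:ℕ) * t ^ 2 = 2 ^ (j:ℕ) * t * (2 ^ (l:ℕ) * t) by ring, pow_add]
      field_simp

theorem aux_taylor {I : Set ℝ} (hc : Convex ℝ I) (h0 : (0:ℝ) ∈ I) {f : ℝ → ℝ} {M : ℕ}
    (hf : ContDiffWithinAt ℝ M f I 0) :
    (fun x => f x - ∑ k ∈ Finset.range (M + 1),
      (iteratedDerivWithin k f I 0 / (Nat.factorial k : ℝ)) * x ^ k) =o[𝓝[I] 0] fun x => x ^ M := by
  obtain ⟨u, huo, h0u, hfu⟩ := hf.contDiffOn' le_rfl (by simp)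
  obtain ⟨ε, hε, hball⟩ := Metric.isOpen_iff.1 huo 0 h0u
  rw [insert_eq_of_mem h0] at hfu
  have hb : Metric.ball (0:ℝ) ε ∈ 𝓝 (0:ℝ) := Metric.ball_mem_nhds _ hε
  have h := taylor_isLittleO (hc.inter (convex_ball (0:ℝ) ε)) ⟨h0, Metric.mem_ball_self hε⟩
    (hfu.mono (inter_subset_inter_right _ hball))
  rw [nhdsWithin_inter_of_mem' (mem_nhdsWithin_of_mem_nhds hb)] at h
  simp only [taylor_within_apply, sub_zero] at h
  refine h.congr_left fun x => congrArg (fun z => f x - z) ?_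
  refine Finset.sum_congr rfl fun k _ => ?_
  have : iteratedDerivWithin k f (I ∩ Metric.ball 0 ε) 0 = iteratedDerivWithin k f I 0 := by
    simp only [iteratedDerivWithin, iteratedFDerivWithin_inter hb]
  rw [this, smul_eq_mul]; ring

/-- Let `I = [0,R)` or `(-R,R)` with `0 < R ≤ ∞`, `n ≥ 2`, and suppose `f` admits at least
`n-1` nonzero derivatives at `0` (within `I`), of orders `m 0 < ⋯ < m (n-2)`, all other
derivatives of order below `m (n-2)` vanishing at `0`.  If `f[A]` is positive semidefinite
for every rank-one positive semidefinite `A` with entries in `I`, then the Taylor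
coefficients at the orders `m i` are positive and `f` dominates the corresponding Taylor
polynomial on `I ∩ [0,∞)`. -/
theorem rank_one_positivity_taylor_bound
    (R : EReal) (hR : 0 < R) (I : Set ℝ)
    (hI : I = {x : ℝ | 0 ≤ x ∧ (x : EReal) < R} ∨
          I = {x : ℝ | -R < (x : EReal) ∧ (x : EReal) < R})
    (f : ℝ → ℝ) (n : ℕ) (hn : 2 ≤ n)
    (m : Fin (n - 1) → ℕ) (hm : StrictMono m)
    (hdiff : ContDiffWithinAt ℝ (m ⟨n - 2, by omega⟩) f I 0)
    (hnz : ∀ i : Fin (n - 1), iteratedDerivWithin (m i) f I 0 ≠ 0)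
    (hzero : ∀ j < m ⟨n - 2, by omega⟩, (∀ i : Fin (n - 1), j ≠ m i) →
      iteratedDerivWithin j f I 0 = 0)
    (hmap : ∀ A : Matrix (Fin n) (Fin n) ℝ, A.PosSemidef → A.rank ≤ 1 →
      (∀ i j, A i j ∈ I) → (A.map f).PosSemidef) :
    (∀ i : Fin (n - 1), 0 < iteratedDerivWithin (m i) f I 0) ∧
    ∀ x ∈ I, 0 ≤ x →
      ∑ i : Fin (n - 1),
        (iteratedDerivWithin (m i) f I 0 / (Nat.factorial (m i) : ℝ)) * x ^ (m i) ≤ f x := by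
  obtain ⟨N, rfl⟩ : ∃ N, n = N + 2 := ⟨n - 2, by omega⟩
  obtain ⟨hconv, h0, δ, hδ, hIδ⟩ :
      Convex ℝ I ∧ (0:ℝ) ∈ I ∧ ∃ δ : ℝ, 0 < δ ∧ Ico 0 δ ⊆ I := by
    obtain ⟨δ, hδ, hδR⟩ := EReal.lt_iff_exists_real_btwn.1 hR
    have hδ' : 0 < δ := by exact_mod_cast hδ
    rcases hI with rfl | rfl
    · refine ⟨?_, ⟨le_rfl, hR⟩, δ, hδ', fun x hx => ⟨hx.1, ?_⟩⟩
      · rw [convex_iff_ordConnected]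
        refine ⟨fun a ha b hb z hz => ⟨ha.1.trans hz.1, lt_of_le_of_lt ?_ hb.2⟩⟩
        exact_mod_cast hz.2
      · exact lt_trans (by exact_mod_cast hx.2) hδR
    · have hneg : -R < 0 := by simpa using EReal.neg_lt_neg_iff.2 hR
      refine ⟨?_, ⟨hneg, hR⟩, δ, hδ', fun x hx => ⟨?_, ?_⟩⟩
      · rw [convex_iff_ordConnected]
        refine ⟨fun a ha b hb z hz => ⟨lt_of_lt_of_le ha.1 ?_, lt_of_le_of_lt ?_ hb.2⟩⟩
        · exact_mod_cast hz.1
        · exact_mod_cast hz.2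
      · exact lt_of_lt_of_le hneg (by exact_mod_cast hx.1)
      · exact lt_trans (by exact_mod_cast hx.2) hδR
  have hT := aux_taylor hconv h0 hdiff
  set M := m ⟨N + 2 - 2, by omega⟩ with hMdef
  have hM : ∀ i, m i ≤ M := fun i => hm.monotone (by
    rw [Fin.le_def]; have := i.2; simp only; omega)
  have hsum : ∀ x : ℝ, ∑ k ∈ Finset.range (M + 1),
      (iteratedDerivWithin k f I 0 / (Nat.factorial k : ℝ)) * x ^ k =
      ∑ i, (iteratedDerivWithin (m i) f I 0 / (Nat.factorial (m i) : ℝ)) * x ^ (m i) := by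
    intro x
    rw [← Finset.sum_image (s := Finset.univ) (g := m)
      (f := fun k => (iteratedDerivWithin k f I 0 / (Nat.factorial k : ℝ)) * x ^ k)
      (fun a _ b _ h => hm.injective h)]
    symm
    refine Finset.sum_subset (fun k hk => ?_) (fun k hk hk' => ?_)
    · obtain ⟨i, -, rfl⟩ := Finset.mem_image.1 hk
      exact Finset.mem_range.2 (Nat.lt_succ_of_le (hM i))
    · have hne : ∀ i, k ≠ m i := fun i h =>
        hk' (Finset.mem_image.2 ⟨i, Finset.mem_univ _, h.symm⟩)
      have hlt : k < M := lt_of_le_of_ne (Nat.lt_succ_iff.1 (Finset.mem_range.1 hk)) (hne _)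
      rw [hzero k hlt hne]; simp
  simp only [hsum] at hT
  obtain ⟨h1, h2⟩ := aux_core (N := N + 1) (m := m)
    (c := fun i => iteratedDerivWithin (m i) f I 0 / (Nat.factorial (m i) : ℝ))
    hδ hIδ hm hM hT (fun x => by simp) hmap
  refine ⟨fun i => lt_of_le_of_ne ?_ (hnz i).symm, h2⟩
  have hp : (0:ℝ) < Nat.factorial (m i) := by exact_mod_cast Nat.factorial_pos _
  have := mul_nonneg (h1 i) hp.le
  rwa [div_mul_cancel₀ _ hp.ne'] at this
end

section
/- Let 0 < R ≤ ∞ and let I = [0,R) or I = (-R,R). Fix integers n ≥ 2, 1 ≤ k < n−1, and 2 ≤ l ≤ n. Suppose f : I → ℝ is k times continuously differentiable on I. Then the following are equivalent: (1) f[A] ∈ S_n^k for all A ∈ P_n^l(I); (2) f(x) = Σ_{t=1}^r a_t x^{i_t} on I for some nonzero reals a_t and distinct nonnegative integers i_1,…,i_r satisfying Σ_{t=1}^r C(i_t + l − 1, l − 1) ≤ k, where C(·,·) denotes the binomial coefficient. Similarly, f[A] ∈ P_n^k for all A ∈ P_n^l(I) if and only if f satisfies (2) with all coefficients a_t > 0.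 -/
open Matrix Set

lemma aux_minor {X : Type*} [Nonempty X] (K : X → X → ℝ) (n k : ℕ)
    (h : ∀ v : Fin n → X, (Matrix.of fun i j => K (v i) (v j)).rank ≤ k)
    {ι : Type*} [Fintype ι] [DecidableEq ι] (hc : Fintype.card ι ≤ n) (v : ι → X) :
    (Matrix.of fun i j => K (v i) (v j)).rank ≤ k := by
  obtain ⟨e⟩ : Nonempty (ι ↪ Fin n) := by
    apply Function.Embedding.nonempty_of_card_le; simpa using hc
  let w : Fin n → X := Function.extend e v (fun _ => Classical.arbitrary X)
  have := h w
  have h2 : (Matrix.of fun i j => K (v i) (v j)) =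
      (Matrix.of fun i j => K (w i) (w j)).submatrix e e := by
    ext i j
    simp [w, e.injective.extend_apply]
  rw [h2]
  exact (Matrix.rank_submatrix_le _ _ _).trans this

lemma aux_finrank {X : Type*} [Nonempty X] (K : X → X → ℝ) (hK : ∀ x y, K x y = K y x)
    (n k : ℕ) (hkn : k + 2 ≤ n)
    (h : ∀ v : Fin n → X, (Matrix.of fun i j => K (v i) (v j)).rank ≤ k) :
    ∃ V : Submodule ℝ (X → ℝ), FiniteDimensional ℝ V ∧ Module.finrank ℝ V ≤ k ∧
      ∀ y, (fun x => K x y) ∈ V := by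
  classical
  let P : ℕ → Prop := fun r => ∃ u : Fin r → X, (Matrix.of fun i j => K (u i) (u j)).det ≠ 0
  have hP0 : P 0 := ⟨Fin.elim0, by simp⟩
  have hP : ∀ r ≤ n, P r → r ≤ k := by
    rintro r hr ⟨u, hu⟩
    have h1 := Matrix.rank_of_det_ne_zero hu
    have h2 := aux_minor K n k h (by simpa using hr) u
    rw [h1] at h2; simpa using h2
  let r := Nat.findGreatest P k
  have hrk : r ≤ k := Nat.findGreatest_le k
  have hr : P r := Nat.findGreatest_spec (Nat.zero_le k) hP0
  have hmax : ∀ m, r < m → m ≤ n → ¬ P m := by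
    intro m hm hmn hPm
    exact Nat.findGreatest_is_greatest hm (hP m hmn hPm) hPm
  have hdet : ∀ {ι : Type} [Fintype ι] [DecidableEq ι] (v : ι → X), r < Fintype.card ι →
      Fintype.card ι ≤ n → (Matrix.of fun i j => K (v i) (v j)).det = 0 := by
    intro ι _ _ v h1 h2
    by_contra h3
    apply hmax _ h1 h2
    let e := Fintype.equivFin ι
    refine ⟨v ∘ e.symm, ?_⟩
    have : (Matrix.of fun i j => K ((v ∘ e.symm) i) ((v ∘ e.symm) j)) =
      (Matrix.of fun i j => K (v i) (v j)).submatrix e.symm e.symm := rfl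
    rw [this, Matrix.det_submatrix_equiv_self]
    exact h3
  obtain ⟨u, hu⟩ := hr
  set M : Matrix (Fin r) (Fin r) ℝ := Matrix.of fun i j => K (u i) (u j) with hM
  have : Invertible M := Matrix.invertibleOfIsUnitDet _ (isUnit_iff_ne_zero.2 hu)
  let S : X → X → ℝ := fun x y => K x y - ∑ i, (∑ j, K x (u j) * (⅟M) j i) * K (u i) y
  have hschur : ∀ (m : ℕ) (w : Fin m → X), r < r + m → r + m ≤ n →
      (Matrix.of fun i j => S (w i) (w j)).det = 0 := by
    intro m w h1 h2
    have h3 := hdet (Sum.elim u w) (by simpa using h1) (by simpa using h2)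
    have h4 : (Matrix.of fun i j => K (Sum.elim u w i) (Sum.elim u w j)) =
      Matrix.fromBlocks M (Matrix.of fun i j => K (u i) (w j))
        (Matrix.of fun i j => K (w i) (u j)) (Matrix.of fun i j => K (w i) (w j)) := by
      ext i j
      rcases i with i | i <;> rcases j with j | j <;> simp [hM]
    rw [h4, Matrix.det_fromBlocks₁₁] at h3
    have h5 := (mul_eq_zero.1 h3).resolve_left hu
    rw [← h5]
    congr 1
  have hS1 : ∀ x, S x x = 0 := by
    intro x
    have := hschur 1 (fun _ => x) (by omega) (by omega)
    simpa using this
  have hMs : (⅟M)ᵀ = ⅟M := by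
    have : Mᵀ = M := by ext i j; simp [hM, hK (u j)]
    rw [Matrix.invOf_eq_nonsing_inv, Matrix.transpose_nonsing_inv, this]
  have hSs : ∀ x y, S x y = S y x := by
    intro x y
    simp only [S, hK x y, Finset.sum_mul]
    congr 1
    rw [Finset.sum_comm]
    refine Finset.sum_congr rfl fun i _ => Finset.sum_congr rfl fun j _ => ?_
    have : (⅟M) i j = (⅟M) j i := by
      conv_lhs => rw [← hMs]
      rfl
    rw [hK x, hK _ y, this]; ring
  have hS : ∀ x y, S x y = 0 := by
    intro x y
    have := hschur 2 ![x, y] (by omega) (by omega)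
    rw [Matrix.det_fin_two] at this
    simp only [Matrix.of_apply, Matrix.cons_val_zero, Matrix.cons_val_one, hS1, hSs y x] at this
    nlinarith
  refine ⟨Submodule.span ℝ (Set.range fun i => fun x => K x (u i)), ?_, ?_, ?_⟩
  · exact FiniteDimensional.span_of_finite ℝ (Set.finite_range _)
  · refine (finrank_range_le_card _).trans ?_
    simpa using hrk
  · intro y
    have : (fun x => K x y) = ∑ j, (∑ i, (⅟M) j i * K (u i) y) • fun x => K x (u j) := by
      ext x
      have h1 := hS x y
      simp only [S, sub_eq_zero] at h1
      rw [h1]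
      simp only [Finset.sum_apply, Pi.smul_apply, smul_eq_mul, Finset.sum_mul]
      rw [Finset.sum_comm]
      refine Finset.sum_congr rfl fun i _ => Finset.sum_congr rfl fun j _ => ?_
      ring
    rw [this]
    exact Submodule.sum_mem _ fun j _ => Submodule.smul_mem _ _ (Submodule.subset_span ⟨j, rfl⟩)

lemma aux_deriv (f : ℝ → ℝ) (z δ : ℝ) (hδ : 0 < δ) (hδ1 : δ ≤ 1) (k : ℕ)
    (hf : ∀ w, |w - z| < 2 * δ → ContDiffAt ℝ k f w)
    (V : Submodule ℝ ({q : ℝ × ℝ // |q.1 - z| < δ ∧ 0 < q.2 ∧ q.2 < δ} → ℝ))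
    [FiniteDimensional ℝ V] (hVk : Module.finrank ℝ V ≤ k)
    (hV : ∀ t, 0 < t → t < δ → (fun q => f (q.1.1 + t * q.1.2)) ∈ V) :
    iteratedDeriv k f z = 0 := by
  have key : ∀ j ≤ k, ∀ t, 0 < t → t < δ →
      (fun q : {q : ℝ × ℝ // |q.1 - z| < δ ∧ 0 < q.2 ∧ q.2 < δ} =>
        iteratedDeriv j f (q.1.1 + t * q.1.2) * q.1.2 ^ j) ∈ V := by
    intro j
    induction j with
    | zero => intro _ t h1 h2; simpa using hV t h1 h2
    | succ j ih =>
      intro hj t h1 h2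
      have hcl := V.closed_of_finiteDimensional
      let G : ℝ → {q : ℝ × ℝ // |q.1 - z| < δ ∧ 0 < q.2 ∧ q.2 < δ} → ℝ := fun t q =>
        iteratedDeriv j f (q.1.1 + t * q.1.2) * q.1.2 ^ j
      have hder : ∀ q, HasDerivAt (fun t => G t q)
          (iteratedDeriv (j + 1) f (q.1.1 + t * q.1.2) * q.1.2 ^ (j + 1)) t := by
        rintro ⟨⟨w, s⟩, hw, hs, hs'⟩
        simp only [G]
        simp only at hw hs hs'
        have hin : |w + t * s - z| < 2 * δ := by
          have h3 : t * s < δ := by nlinarith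
          have h4 : 0 < t * s := by positivity
          rw [abs_lt] at hw ⊢
          constructor <;> linarith
        have hd : DifferentiableAt ℝ (iteratedDeriv j f) (w + t * s) :=
          by
          have h5 := ContDiffWithinAt.differentiableWithinAt_iteratedDerivWithin (m := j)
            (hf _ hin).contDiffWithinAt (s := univ) (by exact_mod_cast hj)
            (by simp [uniqueDiffOn_univ])
          rw [iteratedDerivWithin_univ, differentiableWithinAt_univ] at h5
          exact h5
        have hd1 := hd.hasDerivAt
        rw [← iteratedDeriv_succ] at hd1
        have hlin : HasDerivAt (fun t : ℝ => w + t * s) s t := by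
          simpa using ((hasDerivAt_id t).mul_const s).const_add w
        have := (hd1.comp t hlin).mul_const (s ^ j)
        simp only [pow_succ']
        rw [← mul_assoc]
        exact this
      have hsl : Filter.Tendsto (slope G t) (nhdsWithin t {t}ᶜ) (nhds (fun q =>
          iteratedDeriv (j + 1) f (q.1.1 + t * q.1.2) * q.1.2 ^ (j + 1))) := by
        rw [tendsto_pi_nhds]
        intro q
        exact (hder q).tendsto_slope
      refine hcl.mem_of_tendsto hsl ?_
      have hnb : ∀ᶠ t' in nhdsWithin t {t}ᶜ, t' ∈ Ioo 0 δ :=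
        nhdsWithin_le_nhds (Ioo_mem_nhds h1 h2)
      filter_upwards [hnb] with t' ht'
      have hj' : j ≤ k := by omega
      exact V.smul_mem _ (V.sub_mem (ih hj' t' ht'.1 ht'.2) (ih hj' t h1 h2))
  let t := δ / 2
  have ht0 : 0 < t := by positivity
  have ht1 : t < δ := by simp only [t]; linarith
  let vv : Fin (k + 1) → V := fun j => ⟨_, key j (by omega) t ht0 ht1⟩
  have hnl : ¬ LinearIndependent ℝ vv := by
    intro h
    have := h.fintype_card_le_finrank
    simp at this; omega
  obtain ⟨g, hg, j, hgj⟩ := Fintype.not_linearIndependent_iff.1 hnl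
  have hrel : ∀ w s, |w - z| < δ → 0 < s → s < δ →
      ∑ i : Fin (k + 1), g i * (iteratedDeriv i f (w + t * s) * s ^ (i : ℕ)) = 0 := by
    intro w s h1 h2 h3
    have := congrArg (fun v : V => v.1 ⟨(w, s), h1, h2, h3⟩) hg
    simpa [vv, Finset.sum_apply] using this
  have hzero : ∀ w, |w - z| < δ / 2 → iteratedDeriv j f w = 0 := by
    intro w hw
    let q : Polynomial ℝ := ∑ i : Fin (k + 1),
      Polynomial.C (g i * iteratedDeriv i f w) * Polynomial.X ^ (i : ℕ)
    have hq : q = 0 := by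
      apply Polynomial.eq_zero_of_infinite_isRoot
      apply (Ioo_infinite hδ).mono
      rintro s ⟨h1, h2⟩
      have h5 := hrel (w - t * s) s (by
        have h3 : t * s < δ / 2 := by simp only [t]; nlinarith
        have h4 : 0 < t * s := by positivity
        rw [abs_lt] at hw ⊢
        constructor <;> linarith) h1 h2
      simp only [mem_ofPred_eq, Polynomial.IsRoot, q, Polynomial.eval_finsetSum]
      rw [← h5]
      refine Finset.sum_congr rfl fun i _ => ?_
      simp; ring
    have hc := congrArg (fun p => Polynomial.coeff p j) hq
    simp only [q, Polynomial.finsetSum_coeff, Polynomial.coeff_C_mul_X_pow,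
      Polynomial.coeff_zero] at hc
    rw [Finset.sum_eq_single j] at hc
    · simp at hc
      exact hc.resolve_left hgj
    · intro b _ hb
      rw [if_neg]
      intro h; exact hb (Fin.ext h.symm)
    · simp
  have hev : ∀ m, iteratedDeriv (j + m) f =ᶠ[nhds z] 0 := by
    intro m
    induction m with
    | zero =>
      have : ∀ᶠ w in nhds z, w ∈ Metric.ball z (δ / 2) := Metric.ball_mem_nhds z (by positivity)
      filter_upwards [this] with w hw
      exact hzero w (by simpa [Real.dist_eq] using hw)
    | succ m ih =>
      have := ih.deriv
      rw [← add_assoc, iteratedDeriv_succ]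
      refine this.trans ?_
      apply Filter.Eventually.of_forall
      intro x
      exact congrFun (deriv_const' (0:ℝ)) x
  have := (hev (k - j)).eq_of_nhds
  rwa [show (j : ℕ) + (k - j) = k by omega] at this

lemma aux_poly (U : Set ℝ) (hU : IsOpen U) (hc : Convex ℝ U) (hne : U.Nonempty) (k : ℕ) :
    ∀ f : ℝ → ℝ, ContDiffOn ℝ k f U → (∀ x ∈ U, iteratedDerivWithin k f U x = 0) →
    ∃ p : Polynomial ℝ, ∀ x ∈ U, f x = p.eval x := by
  induction k with
  | zero => intro f _ h; exact ⟨0, fun x hx => by simpa using h x hx⟩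
  | succ k ih =>
    intro f hf h
    have hd : DifferentiableOn ℝ f U := hf.differentiableOn (by simp)
    obtain ⟨p, hp⟩ := ih (derivWithin f U)
      (((contDiffOn_succ_iff_derivWithin (n := k) hU.uniqueDiffOn).1 (by exact_mod_cast hf)).2.2) (by
      intro x hx
      rw [← iteratedDerivWithin_succ']
      exact h x hx)
    obtain ⟨P, hP⟩ : ∃ P : Polynomial ℝ, P.derivative = p := by
      refine ⟨p.sum fun i a => Polynomial.monomial (i + 1) (a / (i + 1)), ?_⟩
      rw [Polynomial.sum, Polynomial.derivative_sum]
      conv_rhs => rw [p.as_sum_support]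
      refine Finset.sum_congr rfl fun i _ => ?_
      rw [Polynomial.derivative_monomial]
      have : (i : ℝ) + 1 ≠ 0 := by positivity
      congr 1
      push_cast; field_simp
    obtain ⟨x0, hx0⟩ := hne
    refine ⟨P + Polynomial.C (f x0 - P.eval x0), fun x hx => ?_⟩
    have hdf : DifferentiableOn ℝ (fun x => f x - P.eval x) U := hd.sub P.differentiable.differentiableOn
    have := hc.is_const_of_fderivWithin_eq_zero (𝕜 := ℝ) hdf (fun y hy => by
      have h1 : HasDerivAt f (p.eval y) y := by
        have := (hd y hy).hasDerivWithinAt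
        rw [hp y hy] at this
        exact this.hasDerivAt (hU.mem_nhds hy)
      have h2 := P.hasDerivAt y
      rw [hP] at h2
      have h3 := h1.sub h2
      rw [sub_self] at h3
      rw [fderivWithin_of_isOpen hU hy]
      have h4 := h3.hasFDerivAt.fderiv
      rw [show (fun x => f x - P.eval x) = f - fun x => P.eval x from rfl, h4]
      ext; simp) hx hx0
    simp only [Polynomial.eval_add, Polynomial.eval_C]
    linarith

lemma aux_card (l i : ℕ) (hl : 1 ≤ l) :
    (Finset.piAntidiag (Finset.univ : Finset (Fin l)) i).card = Nat.choose (i + l - 1) (l - 1) := by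
  rw [← Finset.map_sym_eq_piAntidiag, Finset.card_map]
  have : (Finset.univ : Finset (Fin l)).sym i = Finset.univ := by simp
  rw [this, Finset.card_univ, Sym.card_sym_eq_choose, Fintype.card_fin,
    show l + i - 1 = i + l - 1 by omega]
  rw [← Nat.choose_symm (by omega)]
  congr 1; omega

lemma aux_indep (l : ℕ) (ε : ℝ) (hε : 0 < ε) (M : Finset (Fin l → ℕ)) (c : (Fin l → ℕ) → ℝ)
    (h : ∀ y : Fin l → ℝ, (∀ i, 0 < y i ∧ y i < ε) → ∑ m ∈ M, c m * ∏ i, y i ^ m i = 0) :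
    ∀ m ∈ M, c m = 0 := by
  intro m hm
  let q : MvPolynomial (Fin l) ℝ :=
    ∑ m ∈ M, MvPolynomial.monomial (Finsupp.equivFunOnFinite.symm m) (c m)
  have hq : q = 0 := by
    apply MvPolynomial.funext_set (fun _ => Ioo 0 ε) (fun _ => Ioo_infinite hε)
    intro x hx
    have h1 := h x (fun i => hx i (mem_univ i))
    rw [map_zero, ← h1]
    simp only [q, map_sum, MvPolynomial.eval_monomial]
    refine Finset.sum_congr rfl fun m _ => ?_
    rw [Finsupp.prod_fintype _ _ (by simp)]
    simp
  have := congrArg (MvPolynomial.coeff (Finsupp.equivFunOnFinite.symm m)) hq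
  simp only [q, MvPolynomial.coeff_sum, MvPolynomial.coeff_monomial, MvPolynomial.coeff_zero] at this
  rw [Finset.sum_eq_single m] at this
  · simpa using this
  · intro b _ hb
    rw [if_neg]
    intro h; exact hb (Finsupp.equivFunOnFinite.symm.injective h)
  · intro h; exact absurd hm h

lemma aux_count (l : ℕ) (hl : 1 ≤ l) (ε : ℝ) (hε : 0 < ε) (k : ℕ) (p : Polynomial ℝ)
    (V : Submodule ℝ ({x : Fin l → ℝ // ∀ i, 0 < x i ∧ x i < ε} → ℝ))
    [FiniteDimensional ℝ V] (hVk : Module.finrank ℝ V ≤ k)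
    (hV : ∀ y : {x : Fin l → ℝ // ∀ i, 0 < x i ∧ x i < ε}, (fun x => p.eval (x.1 ⬝ᵥ y.1)) ∈ V) :
    ∑ i ∈ p.support, Nat.choose (i + l - 1) (l - 1) ≤ k := by
  classical
  let M : Finset (Fin l → ℕ) := p.support.biUnion fun i => Finset.piAntidiag Finset.univ i
  have hdisj : Set.PairwiseDisjoint (p.support : Set ℕ)
      (fun i => Finset.piAntidiag (Finset.univ : Finset (Fin l)) i) := by
    intro i _ j _ hij
    rw [Function.onFun, Finset.disjoint_left]
    intro m h1 h2
    simp at h1 h2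
    exact hij (h1.symm.trans h2)
  have hcard : M.card = ∑ i ∈ p.support, Nat.choose (i + l - 1) (l - 1) := by
    rw [Finset.card_biUnion (fun i hi j hj h => hdisj hi hj h)]
    exact Finset.sum_congr rfl fun i _ => aux_card l i hl
  let w : (Fin l → ℕ) → ℝ := fun m => p.coeff (∑ i, m i) * Nat.multinomial Finset.univ m
  have hw : ∀ m ∈ M, w m ≠ 0 := by
    intro m hm
    simp only [M, Finset.mem_biUnion, Finset.mem_piAntidiag] at hm
    obtain ⟨i, hi, h1, _⟩ := hm
    have h2 : p.coeff (∑ i, m i) ≠ 0 := by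
      rw [h1]; exact Polynomial.mem_support_iff.1 hi
    exact mul_ne_zero h2 (by exact_mod_cast (Nat.multinomial_pos _ _).ne')
  have hexp : ∀ x y : Fin l → ℝ, p.eval (x ⬝ᵥ y) =
      ∑ m ∈ M, (w m * ∏ i, x i ^ m i) * ∏ i, y i ^ m i := by
    intro x y
    rw [Polynomial.eval_eq_sum, Polynomial.sum, Finset.sum_biUnion hdisj]
    refine Finset.sum_congr rfl fun i _ => ?_
    rw [dotProduct, Finset.sum_pow_eq_sum_piAntidiag, Finset.mul_sum]
    refine Finset.sum_congr rfl fun m hm => ?_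
    simp only [Finset.mem_piAntidiag] at hm
    simp only [w, hm.1, mul_pow, Finset.prod_mul_distrib]
    ring
  let φ : (Fin l → ℕ) → ({x : Fin l → ℝ // ∀ i, 0 < x i ∧ x i < ε} → ℝ) :=
    fun m x => ∏ i, x.1 i ^ m i
  have hφ : ∀ m ∈ M, φ m ∈ V := by
    intro m hm
    by_contra hcon
    obtain ⟨F, hF1, hF2⟩ := Submodule.exists_le_ker_of_notMem hcon
    have := aux_indep l ε hε M (fun m => w m * F (φ m)) (by
      intro y hy
      have h1 : F _ = 0 := hF2 (hV ⟨y, hy⟩)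
      have h2 : (fun x : {x : Fin l → ℝ // ∀ i, 0 < x i ∧ x i < ε} => p.eval (x.1 ⬝ᵥ y)) =
          ∑ m ∈ M, (w m * ∏ i, y i ^ m i) • φ m := by
        ext x
        simp only [Finset.sum_apply, Pi.smul_apply, smul_eq_mul, φ]
        rw [hexp]
        exact Finset.sum_congr rfl fun m _ => by ring
      rw [h2, map_sum] at h1
      refine Eq.trans ?_ h1
      refine Finset.sum_congr rfl fun m _ => ?_
      rw [map_smul, smul_eq_mul]; ring) m hm
    exact (mul_ne_zero (hw m hm) hF1) this
  let vv : M → V := fun m => ⟨φ m, hφ m m.2⟩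
  have hli : LinearIndependent ℝ vv := by
    rw [Fintype.linearIndependent_iff]
    intro g hg m
    let c : (Fin l → ℕ) → ℝ := fun m => if h : m ∈ M then g ⟨m, h⟩ else 0
    have := aux_indep l ε hε M c (by
      intro y hy
      have h1 := congrArg (fun v : V => v.1 ⟨y, hy⟩) hg
      simp [vv, Finset.sum_apply, φ] at h1
      rw [← h1, ← Finset.sum_coe_sort]
      refine Finset.sum_congr rfl fun m _ => ?_
      simp [c]) m m.2
    simpa [c] using this
  have := hli.fintype_card_le_finrank
  rw [Fintype.card_coe, hcard] at this
  omega

lemma aux_factor (n l : ℕ) (A : Matrix (Fin n) (Fin n) ℝ) (hA : A.rank ≤ l) :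
    ∃ (B : Matrix (Fin n) (Fin l) ℝ) (C : Matrix (Fin l) (Fin n) ℝ), A = B * C := by
  rw [Matrix.rank_eq_finrank_span_cols] at hA
  set V := Submodule.span ℝ (Set.range A.col) with hV
  let b := Module.finBasis ℝ V
  let w : Fin l → Fin n → ℝ := Function.extend (Fin.castLE hA) (fun i => (b i : Fin n → ℝ)) 0
  have hw : V ≤ Submodule.span ℝ (Set.range w) := by
    intro x hx
    have h1 := b.sum_repr ⟨x, hx⟩
    have h2 := congrArg Subtype.val h1
    simp only [AddSubmonoidClass.coe_finsetSum, Submodule.coe_smul] at h2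
    rw [← h2]
    refine Submodule.sum_mem _ fun i _ => Submodule.smul_mem _ _ (Submodule.subset_span ?_)
    refine ⟨Fin.castLE hA i, ?_⟩
    simp only [w]
    rw [(Fin.castLE_injective hA).extend_apply]
  have hcol : ∀ j, ∃ c : Fin l → ℝ, ∑ s, c s • w s = A.col j := fun j =>
    (Submodule.mem_span_range_iff_exists_fun ℝ).1 (hw (Submodule.subset_span ⟨j, rfl⟩))
  choose c hc using hcol
  refine ⟨Matrix.of fun i s => w s i, Matrix.of fun s j => c j s, ?_⟩
  ext i j
  have := congrFun (hc j) i
  simp only [Finset.sum_apply, Pi.smul_apply, smul_eq_mul, Matrix.col_apply] at this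
  rw [← this, Matrix.mul_apply]
  exact Finset.sum_congr rfl fun s _ => by simp [mul_comm]

lemma aux_back_rank (n l : ℕ) (A : Matrix (Fin n) (Fin n) ℝ) (hA : A.rank ≤ l)
    (r : ℕ) (a : Fin r → ℝ) (e : Fin r → ℕ) :
    (A.map fun x => ∑ t, a t * x ^ e t).rank ≤
      ∑ t, (Finset.piAntidiag (Finset.univ : Finset (Fin l)) (e t)).card := by
  obtain ⟨B, C, rfl⟩ := aux_factor n l A hA
  let J := Σ t : Fin r, (Finset.piAntidiag (Finset.univ : Finset (Fin l)) (e t))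
  let P : Matrix (Fin n) J ℝ := Matrix.of fun i q =>
    a q.1 * (Nat.multinomial Finset.univ q.2.1 * ∏ s, B i s ^ q.2.1 s)
  let Q : Matrix J (Fin n) ℝ := Matrix.of fun q j => ∏ s, C s j ^ q.2.1 s
  have : ((B * C).map fun x => ∑ t, a t * x ^ e t) = P * Q := by
    ext i j
    rw [Matrix.map_apply, Matrix.mul_apply, Matrix.mul_apply, Fintype.sum_sigma]
    refine Finset.sum_congr rfl fun t _ => ?_
    rw [Finset.sum_pow_eq_sum_piAntidiag, Finset.mul_sum, ← Finset.sum_coe_sort]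
    refine Finset.sum_congr rfl fun m _ => ?_
    simp only [P, Q, Matrix.of_apply, mul_pow, Finset.prod_mul_distrib]
    ring
  rw [this]
  refine (Matrix.rank_mul_le_left _ _).trans ((Matrix.rank_le_card_width _).trans ?_)
  simp [J, Fintype.card_sigma]

lemma aux_psd_pow {n : ℕ} (A : Matrix (Fin n) (Fin n) ℝ) (hA : A.PosSemidef) (e : ℕ) :
    (A.map fun x => x ^ e).PosSemidef := by
  induction e with
  | zero =>
    have := Matrix.posSemidef_vecMulVec_self_star (fun _ : Fin n => (1 : ℝ))
    convert this using 1
    ext i j; simp [vecMulVec_apply]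
  | succ e ih =>
    have heq : (A.map fun x => x ^ (e + 1)) = (A.map fun x => x ^ e) ⊙ A := by
      ext i j; simp [pow_succ]
    rw [heq]
    exact ih.hadamard hA

lemma aux_back_psd {n : ℕ} (A : Matrix (Fin n) (Fin n) ℝ) (hA : A.PosSemidef)
    (r : ℕ) (a : Fin r → ℝ) (e : Fin r → ℕ) (ha : ∀ t, 0 < a t) :
    (A.map fun x => ∑ t, a t * x ^ e t).PosSemidef := by
  have : (A.map fun x => ∑ t, a t * x ^ e t) = ∑ t, a t • A.map fun x => x ^ e t := by
    ext i j
    simp [Matrix.sum_apply]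
  rw [this]
  exact Matrix.posSemidef_sum _ fun t _ => (aux_psd_pow A hA _).smul (ha t).le

lemma aux_choose (e l : ℕ) (hl : 2 ≤ l) : e + 1 ≤ Nat.choose (e + l - 1) (l - 1) := by
  obtain ⟨m, rfl⟩ := Nat.exists_eq_add_of_le hl
  rw [show e + (2 + m) - 1 = e + (m + 1) by omega, show 2 + m - 1 = m + 1 by omega,
    Nat.choose_symm_add.symm]
  calc e + 1 = Nat.choose (e + 1) e := by simp
    _ ≤ _ := Nat.choose_le_choose _ (by omega)

lemma aux_pos (n : ℕ) (ε : ℝ) (hε : 0 < ε) (r : ℕ) (a : Fin r → ℝ) (e : Fin r → ℕ)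
    (he : Function.Injective e) (hen : ∀ t, e t < n)
    (h : ∀ s : Fin n → ℝ, (∀ i, 0 < s i ∧ s i < ε) →
      (Matrix.of fun i j => ∑ t, a t * (s i * s j) ^ e t).PosSemidef) (t₀ : Fin r) :
    0 ≤ a t₀ := by
  let s : Fin n → ℝ := fun i => ε * ((i + 1) / (n + 1))
  have hs : ∀ i, 0 < s i ∧ s i < ε := by
    intro i
    have h1 : (0:ℝ) < (i + 1) / (n + 1) := by positivity
    have h2 : ((i:ℝ) + 1) / (n + 1) < 1 := by
      rw [div_lt_one (by positivity)]
      have : ((i:ℕ):ℝ) < n := by exact_mod_cast i.2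
      linarith
    exact ⟨by positivity, by simp only [s]; nlinarith⟩
  have hinj : Function.Injective s := by
    intro i j hij
    simp only [s] at hij
    have h1 : ((i:ℝ) + 1) / (n + 1) = (j + 1) / (n + 1) := mul_left_cancel₀ hε.ne' hij
    have h2 : (n : ℝ) + 1 ≠ 0 := by positivity
    rw [div_left_inj' h2] at h1
    have h3 : ((i:ℕ):ℝ) = (j:ℕ) := by linarith
    exact Fin.ext (by exact_mod_cast h3)
  have hdet : (Matrix.vandermonde s).det ≠ 0 := Matrix.det_vandermonde_ne_zero_iff.2 hinj
  let V := Matrix.vandermonde s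
  let m₀ : Fin n := ⟨e t₀, hen t₀⟩
  let c : Fin n → ℝ := Pi.single m₀ 1 ᵥ* V⁻¹
  have hc : c ᵥ* V = Pi.single m₀ 1 := by
    simp only [c]
    rw [Matrix.vecMul_vecMul, Matrix.nonsing_inv_mul _ (isUnit_iff_ne_zero.2 hdet),
      Matrix.vecMul_one]
  have hc' : ∀ t, ∑ i, c i * s i ^ e t = if t = t₀ then 1 else 0 := by
    intro t
    have h1 := congrFun hc ⟨e t, hen t⟩
    simp only [Matrix.vecMul, dotProduct, V, Matrix.vandermonde_apply] at h1
    rw [h1, Pi.single_apply]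
    simp only [m₀, Fin.mk.injEq, he.eq_iff]
  have hq := (h s hs).dotProduct_mulVec_nonneg c
  have : star c ⬝ᵥ (Matrix.of fun i j => ∑ t, a t * (s i * s j) ^ e t) *ᵥ c = a t₀ := by
    calc _ = ∑ t, a t * (∑ i, c i * s i ^ e t) * (∑ j, c j * s j ^ e t) := by
          simp only [dotProduct, Matrix.mulVec, Matrix.of_apply, Pi.star_apply, star_trivial,
            Finset.mul_sum, Finset.sum_mul]
          rw [Finset.sum_comm]
          rw [Finset.sum_comm' (t' := Finset.univ) (s' := fun _ => Finset.univ) (by simp)]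
          simp_rw [Finset.sum_comm (s := (Finset.univ : Finset (Fin n))) (t := (Finset.univ : Finset (Fin r)))]
          refine Finset.sum_congr rfl fun t _ => ?_
          refine Finset.sum_congr rfl fun i _ => Finset.sum_congr rfl fun j _ => ?_
          rw [mul_pow]; ring
      _ = a t₀ := by
          simp only [hc']
          rw [Finset.sum_eq_single t₀] <;> simp +contextual
  rw [this] at hq
  exact hq

/-- A vector supported on the first two coordinates. -/
def auxPt (l : ℕ) (a b : ℝ) : Fin l → ℝ := fun i => if i.1 = 0 then a else if i.1 = 1 then b else 0

lemma auxPt_dot (l : ℕ) (hl : 2 ≤ l) (a b a' b' : ℝ) :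
    auxPt l a b ⬝ᵥ auxPt l a' b' = a * a' + b * b' := by
  obtain ⟨m, rfl⟩ := Nat.exists_eq_add_of_le' hl
  simp [dotProduct, auxPt, Fin.sum_univ_succ]

lemma aux_cs {l : ℕ} (x y : Fin l → ℝ) : x ⬝ᵥ y ≤ max (x ⬝ᵥ x) (y ⬝ᵥ y) ∧
    -(x ⬝ᵥ y) ≤ max (x ⬝ᵥ x) (y ⬝ᵥ y) := by
  have h1 : 0 ≤ (x - y) ⬝ᵥ (x - y) := by
    simp only [dotProduct]; exact Finset.sum_nonneg fun i _ => mul_self_nonneg _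
  have h2 : 0 ≤ (x + y) ⬝ᵥ (x + y) := by
    simp only [dotProduct]; exact Finset.sum_nonneg fun i _ => mul_self_nonneg _
  simp only [sub_dotProduct, dotProduct_sub, add_dotProduct, dotProduct_add,
    dotProduct_comm y x] at h1 h2
  have h3 := le_max_left (x ⬝ᵥ x) (y ⬝ᵥ y)
  have h4 := le_max_right (x ⬝ᵥ x) (y ⬝ᵥ y)
  constructor <;> linarith

lemma aux_max {R : EReal} {a b c : ℝ} (ha : (a : EReal) < R) (hb : (b : EReal) < R)
    (hc : c ≤ max a b) : (c : EReal) < R := by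
  rcases le_max_iff.1 hc with h | h
  · exact lt_of_le_of_lt (by exact_mod_cast h) ha
  · exact lt_of_le_of_lt (by exact_mod_cast h) hb

lemma aux_box (R : EReal) (hR : 0 < R) (l : ℕ) :
    ∃ ε : ℝ, 0 < ε ∧ ∀ x : Fin l → ℝ, (∀ i, 0 < x i ∧ x i < ε) → ((x ⬝ᵥ x : ℝ) : EReal) < R := by
  obtain ⟨ρ, h1, h2⟩ := EReal.lt_iff_exists_real_btwn.1 hR
  have hρ : 0 < ρ := by exact_mod_cast h1
  refine ⟨min 1 (ρ / (l + 1)), by positivity, fun x hx => ?_⟩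
  refine lt_of_le_of_lt ?_ h2
  have h3 : x ⬝ᵥ x ≤ ∑ _i : Fin l, ρ / (l + 1) := by
    refine Finset.sum_le_sum fun i _ => ?_
    have h4 := (hx i).2.le.trans (min_le_left _ _)
    have h5 := (hx i).2.le.trans (min_le_right _ _)
    nlinarith [(hx i).1]
  have h6 : ∑ _i : Fin l, ρ / ((l:ℝ) + 1) ≤ ρ := by
    simp only [Finset.sum_const, Finset.card_univ, Fintype.card_fin, nsmul_eq_mul]
    rw [mul_div_assoc', div_le_iff₀ (by positivity)]
    nlinarith
  exact_mod_cast h3.trans h6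

lemma aux_near (R : EReal) (z : ℝ) (hz : ((|z| : ℝ) : EReal) < R) :
    ∃ c : ℝ, 0 < c ∧ ∃ δ : ℝ, 0 < δ ∧
      (∀ t, 0 < t → t < δ → ((c * c + t * t : ℝ) : EReal) < R) ∧
      (∀ w s, |w - z| < δ → 0 < s → s < δ → ((w / c * (w / c) + s * s : ℝ) : EReal) < R) := by
  obtain ⟨ρ, h1, h2⟩ := EReal.lt_iff_exists_real_btwn.1 hz
  have h1' : |z| < ρ := by exact_mod_cast h1
  obtain ⟨σ, h3, h4⟩ := exists_between h1'
  have hσ : 0 < σ := (abs_nonneg z).trans_lt h3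
  have hc : 0 < √σ := Real.sqrt_pos.2 hσ
  have hcc : √σ * √σ = σ := Real.mul_self_sqrt hσ.le
  have e1 : ∀ᶠ t in nhds (0:ℝ), √σ * √σ + t * t < ρ := by
    have : Filter.Tendsto (fun t : ℝ => √σ * √σ + t * t) (nhds 0) (nhds (√σ * √σ + 0 * 0)) :=
      Continuous.tendsto (by fun_prop) _
    exact this.eventually_lt_const (by rw [hcc]; simpa using h4)
  have e2 : ∀ᶠ q in nhds ((z, 0) : ℝ × ℝ), q.1 / √σ * (q.1 / √σ) + q.2 * q.2 < ρ := by
    have : Filter.Tendsto (fun q : ℝ × ℝ => q.1 / √σ * (q.1 / √σ) + q.2 * q.2) (nhds (z, 0))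
      (nhds (z / √σ * (z / √σ) + 0 * 0)) :=
      Continuous.tendsto (f := fun q : ℝ × ℝ => q.1 / √σ * (q.1 / √σ) + q.2 * q.2) (by fun_prop) (z, 0)
    refine this.eventually_lt_const ?_
    rw [div_mul_div_comm, hcc, mul_zero, add_zero, div_lt_iff₀ hσ, ← abs_mul_abs_self]
    nlinarith [abs_nonneg z]
  obtain ⟨δ1, hδ1, H1⟩ := Metric.eventually_nhds_iff.1 e1
  obtain ⟨δ2, hδ2, H2⟩ := Metric.eventually_nhds_iff.1 e2
  refine ⟨√σ, hc, min δ1 δ2, lt_min hδ1 hδ2, ?_, ?_⟩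
  · intro t h5 h6
    refine lt_trans ?_ h2
    have := H1 (y := t) (by
      rw [Real.dist_eq, sub_zero, abs_of_pos h5]; exact h6.trans_le (min_le_left _ _))
    exact_mod_cast this
  · intro w s h5 h6 h7
    refine lt_trans ?_ h2
    have := H2 (y := (w, s)) (by
      rw [Prod.dist_eq, max_lt_iff]
      simp only [Real.dist_eq, sub_zero, abs_of_pos h6]
      exact ⟨h5.trans_le (min_le_right _ _), h7.trans_le (min_le_right _ _)⟩)
    exact_mod_cast this

lemma aux_geom (R : EReal) (hR : 0 < R) (I : Set ℝ)
    (hI : I = {x : ℝ | 0 ≤ x ∧ (x : EReal) < R} ∨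
          I = {x : ℝ | -R < (x : EReal) ∧ (x : EReal) < R}) (l : ℕ) (hl : 2 ≤ l) :
    ∃ (U : Set ℝ) (D : Set (Fin l → ℝ)), IsOpen U ∧ Convex ℝ U ∧ U.Nonempty ∧ U ⊆ I ∧
      I ⊆ closure U ∧ (∀ x ∈ D, ∀ y ∈ D, x ⬝ᵥ y ∈ I) ∧
      (∃ ε : ℝ, 0 < ε ∧ ∀ x : Fin l → ℝ, (∀ i, 0 < x i ∧ x i < ε) → x ∈ D) ∧
      ∀ z ∈ U, ∃ c : ℝ, 0 < c ∧ ∃ δ : ℝ, 0 < δ ∧ δ ≤ 1 ∧ (∀ w, |w - z| < 2 * δ → w ∈ U) ∧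
        (∀ t, 0 < t → t < δ → auxPt l c t ∈ D) ∧
        (∀ w s, |w - z| < δ → 0 < s → s < δ → auxPt l (w / c) s ∈ D) := by
  obtain ⟨ε, hε, hbox⟩ := aux_box R hR l
  have hcont : Continuous (fun x : ℝ => (x : EReal)) := continuous_coe_real_ereal
  obtain ⟨ρ, hρ1, hρ2⟩ := EReal.lt_iff_exists_real_btwn.1 hR
  have hρ : 0 < ρ := by exact_mod_cast hρ1
  have hopen : ∀ U : Set ℝ, IsOpen U → ∀ z ∈ U, ∃ δ : ℝ, 0 < δ ∧ ∀ w, |w - z| < 2 * δ → w ∈ U := by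
    intro U hU z hz
    obtain ⟨η, h1, h2⟩ := Metric.isOpen_iff.1 hU z hz
    refine ⟨η / 2, by positivity, fun w hw => h2 ?_⟩
    rw [Metric.mem_ball, Real.dist_eq]; linarith
  rcases hI with rfl | rfl
  · let U : Set ℝ := {x : ℝ | 0 < x ∧ (x : EReal) < R}
    have hUo : IsOpen U := (isOpen_lt continuous_const continuous_id).inter
      (isOpen_lt hcont continuous_const)
    refine ⟨U, {x | ((x ⬝ᵥ x : ℝ) : EReal) < R ∧ ∀ i, 0 ≤ x i}, hUo, ?_, ⟨ρ, hρ, hρ2⟩,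
      fun x hx => ⟨hx.1.le, hx.2⟩, ?_, ?_, ⟨ε, hε, fun x hx => ⟨hbox x hx, fun i => (hx i).1.le⟩⟩, ?_⟩
    · apply OrdConnected.convex
      constructor
      intro x hx y hy w hw
      exact ⟨hx.1.trans_le hw.1, lt_of_le_of_lt (by exact_mod_cast hw.2) hy.2⟩
    · rintro x ⟨h1, h2⟩
      rcases h1.eq_or_lt with rfl | h1
      · have : Ioo 0 ρ ⊆ U := fun y hy => ⟨hy.1, lt_trans (by exact_mod_cast hy.2) hρ2⟩
        apply closure_mono this
        rw [closure_Ioo hρ.ne]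
        exact ⟨le_rfl, hρ.le⟩
      · exact subset_closure ⟨h1, h2⟩
    · rintro x ⟨hx, hx'⟩ y ⟨hy, hy'⟩
      exact ⟨Finset.sum_nonneg fun i _ => mul_nonneg (hx' i) (hy' i), aux_max hx hy (aux_cs x y).1⟩
    · intro z hz
      obtain ⟨c, hc, δ, hδ, H1, H2⟩ := aux_near R z (by rw [abs_of_pos hz.1]; exact hz.2)
      obtain ⟨η, hη, H3⟩ := hopen U hUo z hz
      have hm1 : min 1 (min δ η) ≤ δ := (min_le_right _ _).trans (min_le_left _ _)
      have hm2 : min 1 (min δ η) ≤ η := (min_le_right _ _).trans (min_le_right _ _)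
      have hpt : ∀ a b : ℝ, 0 ≤ a → 0 ≤ b → ∀ i, 0 ≤ auxPt l a b i := by
        intro a b ha hb i
        simp only [auxPt]; split_ifs <;> first | assumption | exact le_rfl
      refine ⟨c, hc, min 1 (min δ η), by positivity, min_le_left _ _,
        fun w hw => H3 w (by linarith), fun t h1 h2 => ⟨?_, hpt _ _ hc.le h1.le⟩,
        fun w s h1 h2 h3 => ⟨?_, hpt _ _ (div_nonneg ?_ hc.le) h2.le⟩⟩
      · rw [auxPt_dot l hl]; exact H1 t h1 (by linarith)
      · rw [auxPt_dot l hl]; exact H2 w s (by linarith) h2 (by linarith)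
      · exact (H3 w (by linarith)).1.le
  · set U : Set ℝ := {x : ℝ | -R < (x : EReal) ∧ (x : EReal) < R} with hU
    have hUo : IsOpen U := (isOpen_lt continuous_const hcont).inter
      (isOpen_lt hcont continuous_const)
    have hneg : ∀ x : ℝ, -R < (x : EReal) ↔ ((-x : ℝ) : EReal) < R := by
      intro x
      rw [EReal.coe_neg]; exact EReal.neg_lt_comm
    refine ⟨U, {x | ((x ⬝ᵥ x : ℝ) : EReal) < R}, hUo, ?_, ⟨0, ?_, ?_⟩,
      subset_rfl, subset_closure, ?_, ⟨ε, hε, hbox⟩, ?_⟩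
    · apply OrdConnected.convex
      constructor
      intro x hx y hy w hw
      exact ⟨lt_of_lt_of_le hx.1 (by exact_mod_cast hw.1),
        lt_of_le_of_lt (by exact_mod_cast hw.2) hy.2⟩
    · rw [hneg]; simpa using hR
    · simpa using hR
    · intro x hx y hy
      exact ⟨(hneg _).2 (aux_max hx hy (aux_cs x y).2), aux_max hx hy (aux_cs x y).1⟩
    · intro z hz
      obtain ⟨c, hc, δ, hδ, H1, H2⟩ := aux_near R z (aux_max hz.2 ((hneg z).1 hz.1) le_rfl)
      obtain ⟨η, hη, H3⟩ := hopen U hUo z hz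
      have hm1 : min 1 (min δ η) ≤ δ := (min_le_right _ _).trans (min_le_left _ _)
      have hm2 : min 1 (min δ η) ≤ η := (min_le_right _ _).trans (min_le_right _ _)
      refine ⟨c, hc, min 1 (min δ η), by positivity, min_le_left _ _,
        fun w hw => H3 w (by linarith), fun t h1 h2 => ?_, fun w s h1 h2 h3 => ?_⟩
      · change ((_ : ℝ) : EReal) < R
        rw [auxPt_dot l hl]; exact H1 t h1 (by linarith)
      · change ((_ : ℝ) : EReal) < R
        rw [auxPt_dot l hl]; exact H2 w s (by linarith) h2 (by linarith)

lemma aux_forward (R : EReal) (hR : 0 < R) (I : Set ℝ)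
    (hI : I = {x : ℝ | 0 ≤ x ∧ (x : EReal) < R} ∨
          I = {x : ℝ | -R < (x : EReal) ∧ (x : EReal) < R})
    (n k l : ℕ) (hkn : k < n - 1) (hl : 2 ≤ l)
    (f : ℝ → ℝ) (hf : ContDiffOn ℝ k f I)
    (h : ∀ A : Matrix (Fin n) (Fin n) ℝ, A.PosSemidef → A.rank ≤ l → (∀ i j, A i j ∈ I) →
        (A.map f).rank ≤ k) :
    ∃ p : Polynomial ℝ, (∀ x ∈ I, f x = p.eval x) ∧
      ∑ i ∈ p.support, Nat.choose (i + l - 1) (l - 1) ≤ k := by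
  obtain ⟨U, D, hUo, hUc, hUne, hUI, hIU, hD, ⟨ε, hε, hbox⟩, hnear⟩ := aux_geom R hR I hI l hl
  have hDne : Nonempty D :=
    ⟨⟨fun _ => ε / 2, hbox _ fun _ => ⟨by positivity, by linarith⟩⟩⟩
  obtain ⟨V, hVf, hVk, hV⟩ := aux_finrank (fun x y : D => f (x.1 ⬝ᵥ y.1))
    (fun x y => by rw [dotProduct_comm]) n k (by omega) (by
      intro v
      let B : Matrix (Fin n) (Fin l) ℝ := Matrix.of fun i s => (v i).1 s
      have hA : ∀ i j, (B * Bᴴ) i j = (v i).1 ⬝ᵥ (v j).1 := by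
        intro i j
        simp [B, Matrix.mul_apply, dotProduct]
      have h1 := h (B * Bᴴ) (Matrix.posSemidef_self_mul_conjTranspose B)
        ((Matrix.rank_mul_le_left _ _).trans ((Matrix.rank_le_card_width _).trans (by simp)))
        (fun i j => by rw [hA]; exact hD _ (v i).2 _ (v j).2)
      convert h1 using 2
      ext i j
      simp only [Matrix.of_apply, Matrix.map_apply, hA])
  have hderiv : ∀ z ∈ U, iteratedDeriv k f z = 0 := by
    intro z hz
    obtain ⟨c, hc, δ, hδ, hδ1, H1, H2, H3⟩ := hnear z hz
    let ψ : {q : ℝ × ℝ // |q.1 - z| < δ ∧ 0 < q.2 ∧ q.2 < δ} → D := fun q =>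
      ⟨auxPt l (q.1.1 / c) q.1.2, H3 _ _ q.2.1 q.2.2.1 q.2.2.2⟩
    refine aux_deriv f z δ hδ hδ1 k (fun w hw => (hf.mono hUI).contDiffAt (hUo.mem_nhds (H1 w hw)))
      (V.map (LinearMap.funLeft ℝ ℝ ψ)) ((Submodule.finrank_map_le _ _).trans hVk) ?_
    intro t h1 h2
    refine ⟨_, hV ⟨auxPt l c t, H2 t h1 h2⟩, ?_⟩
    ext q
    simp only [LinearMap.funLeft_apply, ψ]
    rw [auxPt_dot l hl]
    congr 1
    field_simp
  obtain ⟨p, hp⟩ := aux_poly U hUo hUc hUne k f (hf.mono hUI) (fun x hx => by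
    rw [iteratedDerivWithin_of_isOpen hUo hx]; exact hderiv x hx)
  have hpI : ∀ x ∈ I, f x = p.eval x :=
    Set.EqOn.of_subset_closure hp hf.continuousOn p.continuous.continuousOn hUI hIU
  refine ⟨p, hpI, ?_⟩
  let ψ : {x : Fin l → ℝ // ∀ i, 0 < x i ∧ x i < ε} → D := fun x => ⟨x.1, hbox x.1 x.2⟩
  refine aux_count l (by omega) ε hε k p (V.map (LinearMap.funLeft ℝ ℝ ψ))
    ((Submodule.finrank_map_le _ _).trans hVk) ?_
  intro y
  refine ⟨_, hV (ψ y), ?_⟩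
  ext x
  simp only [LinearMap.funLeft_apply, ψ]
  exact hpI _ (hD _ (hbox x.1 x.2) _ (hbox y.1 y.2))

lemma aux_forward' (R : EReal) (hR : 0 < R) (I : Set ℝ)
    (hI : I = {x : ℝ | 0 ≤ x ∧ (x : EReal) < R} ∨
          I = {x : ℝ | -R < (x : EReal) ∧ (x : EReal) < R})
    (n k l : ℕ) (hkn : k < n - 1) (hl : 2 ≤ l)
    (f : ℝ → ℝ) (hf : ContDiffOn ℝ k f I)
    (h : ∀ A : Matrix (Fin n) (Fin n) ℝ, A.PosSemidef → A.rank ≤ l → (∀ i j, A i j ∈ I) →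
        (A.map f).rank ≤ k) :
    ∃ (r : ℕ) (a : Fin r → ℝ) (e : Fin r → ℕ), (∀ t, a t ≠ 0) ∧ Function.Injective e ∧
        (∑ t, Nat.choose (e t + l - 1) (l - 1)) ≤ k ∧
        ∀ x ∈ I, f x = ∑ t, a t * x ^ e t := by
  obtain ⟨p, hp, hc⟩ := aux_forward R hR I hI n k l hkn hl f hf h
  let E := p.support.equivFin.symm
  refine ⟨p.support.card, fun t => p.coeff (E t), fun t => E t, ?_, ?_, ?_, ?_⟩
  · intro t; exact Polynomial.mem_support_iff.1 (E t).2
  · exact Subtype.val_injective.comp E.injective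
  · rw [E.sum_comp (fun i : p.support => Nat.choose ((i : ℕ) + l - 1) (l - 1)),
      Finset.sum_coe_sort p.support (fun i => Nat.choose (i + l - 1) (l - 1))]
    exact hc
  · intro x hx
    rw [E.sum_comp (fun i : p.support => p.coeff i * x ^ (i : ℕ)),
      Finset.sum_coe_sort p.support (fun i => p.coeff i * x ^ i), hp x hx,
      Polynomial.eval_eq_sum, Polynomial.sum]

/-- **Higher rank, fixed dimension.** Let `I = [0,R)` or `(-R,R)` with `0 < R ≤ ∞`, fix
`n ≥ 2`, `1 ≤ k < n-1`, `2 ≤ l ≤ n`, and let `f ∈ C^k(I)`.  Then `f[A]` is symmetric of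
rank at most `k` for every `A ∈ P_n^l(I)` iff `f` is a sum `Σ a_t x^{i_t}` of finitely many
monomials with nonzero coefficients and distinct exponents satisfying
`Σ_t C(i_t + l - 1, l - 1) ≤ k`; and `f[A] ∈ P_n^k` for all such `A` iff moreover all the
coefficients are positive. -/
theorem higher_rank_fixed_dimension
    (R : EReal) (hR : 0 < R) (I : Set ℝ)
    (hI : I = {x : ℝ | 0 ≤ x ∧ (x : EReal) < R} ∨
          I = {x : ℝ | -R < (x : EReal) ∧ (x : EReal) < R})
    (n k l : ℕ) (hn : 2 ≤ n) (hk : 1 ≤ k) (hkn : k < n - 1) (hl : 2 ≤ l) (hln : l ≤ n)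
    (f : ℝ → ℝ) (hf : ContDiffOn ℝ k f I) :
    ((∀ A : Matrix (Fin n) (Fin n) ℝ, A.PosSemidef → A.rank ≤ l → (∀ i j, A i j ∈ I) →
        (A.map f).IsSymm ∧ (A.map f).rank ≤ k) ↔
      (∃ (r : ℕ) (a : Fin r → ℝ) (e : Fin r → ℕ), (∀ t, a t ≠ 0) ∧ Function.Injective e ∧
        (∑ t, Nat.choose (e t + l - 1) (l - 1)) ≤ k ∧
        ∀ x ∈ I, f x = ∑ t, a t * x ^ e t)) ∧
    ((∀ A : Matrix (Fin n) (Fin n) ℝ, A.PosSemidef → A.rank ≤ l → (∀ i j, A i j ∈ I) →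
        (A.map f).PosSemidef ∧ (A.map f).rank ≤ k) ↔
      (∃ (r : ℕ) (a : Fin r → ℝ) (e : Fin r → ℕ), (∀ t, 0 < a t) ∧ Function.Injective e ∧
        (∑ t, Nat.choose (e t + l - 1) (l - 1)) ≤ k ∧
        ∀ x ∈ I, f x = ∑ t, a t * x ^ e t)) := by
  have hback : ∀ (r : ℕ) (a : Fin r → ℝ) (e : Fin r → ℕ),
      (∑ t, Nat.choose (e t + l - 1) (l - 1)) ≤ k → (∀ x ∈ I, f x = ∑ t, a t * x ^ e t) →
      ∀ A : Matrix (Fin n) (Fin n) ℝ, A.rank ≤ l → (∀ i j, A i j ∈ I) →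
        (A.map f) = (A.map fun x => ∑ t, a t * x ^ e t) ∧ (A.map f).rank ≤ k := by
    intro r a e hs hfe A hA hAI
    have heq : (A.map f) = (A.map fun x => ∑ t, a t * x ^ e t) := by
      ext i j
      simp only [Matrix.map_apply]
      exact hfe _ (hAI i j)
    refine ⟨heq, ?_⟩
    rw [heq]
    refine (aux_back_rank n l A hA r a e).trans ?_
    simp only [aux_card l _ (show 1 ≤ l by omega)]
    exact hs
  refine ⟨⟨fun h => ?_, ?_⟩, ⟨fun h => ?_, ?_⟩⟩
  · exact aux_forward' R hR I hI n k l hkn hl f hf fun A h1 h2 h3 => (h A h1 h2 h3).2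
  · rintro ⟨r, a, e, -, -, hs, hfe⟩ A hA hAl hAI
    refine ⟨?_, (hback r a e hs hfe A hAl hAI).2⟩
    have hsym : Aᵀ = A := by
      have := hA.isHermitian
      rwa [Matrix.IsHermitian, Matrix.conjTranspose_eq_transpose_of_trivial] at this
    rw [Matrix.IsSymm, ← Matrix.transpose_map, hsym]
  · obtain ⟨r, a, e, ha, he, hs, hfe⟩ :=
      aux_forward' R hR I hI n k l hkn hl f hf fun A h1 h2 h3 => (h A h1 h2 h3).2
    refine ⟨r, a, e, fun t => lt_of_le_of_ne ?_ (ha t).symm, he, hs, hfe⟩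
    obtain ⟨U, D, -, -, -, -, -, hD, ⟨ε, hε, hbox⟩, -⟩ := aux_geom R hR I hI l hl
    refine aux_pos n ε hε r a e he (fun t => ?_) (fun s hs' => ?_) t
    · have h1 := aux_choose (e t) l hl
      have h2 := Finset.single_le_sum (f := fun t => Nat.choose (e t + l - 1) (l - 1))
        (fun _ _ => Nat.zero_le _) (Finset.mem_univ t)
      omega
    · have hmem : ∀ i j, s i * s j ∈ I := by
        intro i j
        have hsl : (0:ℝ) < √l := Real.sqrt_pos.2 (by exact_mod_cast (show 0 < l by omega))
        have hsl1 : (1:ℝ) ≤ √l := by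
          rw [Real.one_le_sqrt]; exact_mod_cast (show 1 ≤ l by omega)
        have hin : ∀ i, (fun _ : Fin l => s i / √l) ∈ D := fun i => hbox _ fun _ =>
          ⟨div_pos (hs' i).1 hsl, lt_of_le_of_lt (div_le_self (hs' i).1.le hsl1) (hs' i).2⟩
        have h2 := hD _ (hin i) _ (hin j)
        have h3 : √(l:ℝ) * √l = l := Real.mul_self_sqrt (by positivity)
        have h4 : (fun _ : Fin l => s i / √l) ⬝ᵥ (fun _ : Fin l => s j / √l) = s i * s j := by
          have hl0 : (l:ℝ) ≠ 0 := by positivity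
          simp only [dotProduct, Finset.sum_const, Finset.card_univ, Fintype.card_fin,
            nsmul_eq_mul]
          rw [div_mul_div_comm, h3]
          field_simp
        rwa [h4] at h2
      have h1 := h (vecMulVec s (star s)) (Matrix.posSemidef_vecMulVec_self_star s)
        ((Matrix.rank_vecMulVec_le _ _).trans (by omega))
        (fun i j => by simpa [vecMulVec_apply] using hmem i j)
      convert h1.1 using 1
      ext i j
      simp only [Matrix.of_apply, Matrix.map_apply, vecMulVec_apply, Pi.star_apply, star_trivial]
      exact (hfe _ (hmem i j)).symm
  · rintro ⟨r, a, e, ha, -, hs, hfe⟩ A hA hAl hAI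
    have h1 := hback r a e hs hfe A hAl hAI
    refine ⟨?_, h1.2⟩
    rw [h1.1]
    exact aux_back_psd A hA r a e ha
end

section
/- Let 0 < R ≤ ∞, I = (0,R), and f : I → ℝ. Then the following are equivalent: (1) for every n ≥ 1, every a ∈ [0,R), and every u ∈ ℝ^n such that a + u_i u_j ∈ I for all i,j, the matrix f[a·1_{n×n} + u uᵀ] is positive semidefinite; (2) for every n ≥ 1 and every A ∈ P_n(I), the matrix f[A] is positive semidefinite; (3) f is absolutely monotonic on I. -/
open Matrix Set

/-- A function is absolutely monotonic on an interval `I` if it is continuous on `I`,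
infinitely differentiable on the interior of `I`, and all its derivatives are
nonnegative on the interior of `I`. -/
def AbsolutelyMonotonicOn (f : ℝ → ℝ) (I : Set ℝ) : Prop :=
  ContinuousOn f I ∧ ContDiffOn ℝ (⊤ : ℕ∞) f (interior I) ∧
    ∀ (k : ℕ), ∀ x ∈ interior I, 0 ≤ iteratedDerivWithin k f (interior I) x

open Filter Topology

/-- Sum form of condition (1) on `(0,r)`. -/
def SRank (r : ℝ) (f : ℝ → ℝ) : Prop :=
  ∀ (n : ℕ) (a : ℝ) (u v : Fin n → ℝ), 0 ≤ a →
    (∀ i j, a + u i * u j ∈ Set.Ioo 0 r) → 0 ≤ ∑ i, ∑ j, v i * v j * f (a + u i * u j)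

lemma srank_nonneg {r : ℝ} {f : ℝ → ℝ} (h : SRank r f) {x : ℝ} (hx : x ∈ Set.Ioo 0 r) :
    0 ≤ f x := by
  have hs : √x * √x = x := Real.mul_self_sqrt hx.1.le
  have := h 1 0 (fun _ => √x) (fun _ => 1) le_rfl (by intro i j; simpa [hs] using hx)
  simpa [hs] using this

lemma srank_two {r : ℝ} {f : ℝ → ℝ} (h : SRank r f) {a p q : ℝ} (ha : 0 ≤ a)
    (h1 : a + p * p ∈ Set.Ioo 0 r) (h2 : a + p * q ∈ Set.Ioo 0 r)
    (h3 : a + q * q ∈ Set.Ioo 0 r) (s t : ℝ) :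
    0 ≤ s * s * f (a + p * p) + 2 * (s * t) * f (a + p * q) + t * t * f (a + q * q) := by
  have := h 2 a ![p, q] ![s, t] ha (by
    intro i j
    fin_cases i <;> fin_cases j <;> simp_all [mul_comm q p])
  simp only [Fin.sum_univ_two, Matrix.cons_val_zero, Matrix.cons_val_one] at this
  rw [mul_comm q p] at this
  linarith

lemma srank_mono {r : ℝ} {f : ℝ → ℝ} (h : SRank r f) : MonotoneOn f (Set.Ioo 0 r) := by
  intro x hx y hy hxy
  set p := √((y - x) / 2) with hp
  have hs : p * p = (y - x) / 2 := Real.mul_self_sqrt (by linarith)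
  have e1 : (x + y) / 2 + p * p = y := by rw [hs]; ring
  have e2 : (x + y) / 2 + p * (-p) = x := by rw [mul_neg, hs]; ring
  have e3 : (x + y) / 2 + (-p) * (-p) = y := by rw [neg_mul_neg, hs]; ring
  have := srank_two h (a := (x + y) / 2) (p := p) (q := -p) (by linarith [hx.1, hy.1])
    (by rwa [e1]) (by rwa [e2]) (by rwa [e3]) 1 (-1)
  rw [e1, e2, e3] at this
  linarith

lemma srank_convex {r : ℝ} {f : ℝ → ℝ} (h : SRank r f) {x q : ℝ} (hx : 0 < x) (hq : 1 ≤ q)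
    (hxq : x * q ^ 3 < r) : f (x * q) - f (x / q) ≤ f (x * q ^ 3) - f (x * q) := by
  have hq0 : 0 < q := by linarith
  have hs : √(x / q) * √(x / q) = x / q := Real.mul_self_sqrt (by positivity)
  set s := √(x / q) with hsd
  have e1 : 0 + s * s = x / q := by rw [zero_add, hs]
  have e2 : 0 + s * (s * q ^ 2) = x * q := by
    rw [zero_add, ← mul_assoc, hs]; field_simp
  have e3 : 0 + (s * q ^ 2) * (s * q ^ 2) = x * q ^ 3 := by
    rw [zero_add, show (s * q ^ 2) * (s * q ^ 2) = (s * s) * q ^ 4 by ring, hs]; field_simp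
  have h13 : q ≤ q ^ 3 := by nlinarith [sq_nonneg q, mul_nonneg hq0.le (sub_nonneg.2 hq)]
  have l2 : x * q ≤ x * q ^ 3 := mul_le_mul_of_nonneg_left h13 hx.le
  have l1 : x / q ≤ x * q := by
    rw [div_le_iff₀ hq0]
    nlinarith [mul_nonneg hx.le (sub_nonneg.2 hq)]
  have := srank_two h (a := 0) (p := s) (q := s * q ^ 2) le_rfl
    (by rw [e1]; exact ⟨by positivity, by linarith⟩)
    (by rw [e2]; exact ⟨by positivity, by linarith⟩)
    (by rw [e3]; exact ⟨by positivity, by linarith⟩) 1 (-1)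
  rw [e1, e2, e3] at this
  linarith

lemma srank_cont {r : ℝ} {f : ℝ → ℝ} (h : SRank r f) : ContinuousOn f (Set.Ioo 0 r) := by
  have hm := srank_mono h
  intro x hx
  apply ContinuousAt.continuousWithinAt
  obtain ⟨hx0, hxr⟩ := hx
  -- right limit
  have hr : Tendsto f (𝓝[>] x) (𝓝 (sInf (f '' Set.Ioo x r))) := by
    have hb : BddBelow (f '' Set.Ioo x r) :=
      ⟨0, by rintro _ ⟨y, hy, rfl⟩; exact srank_nonneg h ⟨hx0.trans hy.1, hy.2⟩⟩
    have hne : (f '' Set.Ioo x r).Nonempty := (Set.nonempty_Ioo.2 hxr).image f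
    rw [Metric.tendsto_nhds]
    intro ε hε
    obtain ⟨_, ⟨y, hy, rfl⟩, hy2⟩ := exists_lt_of_csInf_lt hne (lt_add_of_pos_right _ hε)
    filter_upwards [Ioo_mem_nhdsGT hy.1] with z hz
    have hz1 : sInf (f '' Set.Ioo x r) ≤ f z := csInf_le hb ⟨z, ⟨hz.1, hz.2.trans hy.2⟩, rfl⟩
    have hz2 : f z ≤ f y := hm ⟨hx0.trans hz.1, hz.2.trans hy.2⟩ ⟨hx0.trans hy.1, hy.2⟩ hz.2.le
    rw [Real.dist_eq, abs_lt]
    constructor <;> linarith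
  have k1 : Tendsto (fun q : ℝ => x * q) (𝓝[>] 1) (𝓝[>] x) := by
    apply tendsto_nhdsWithin_of_tendsto_nhds_of_eventually_within
    · apply Tendsto.mono_left _ nhdsWithin_le_nhds
      have : Continuous (fun q : ℝ => x * q) := by fun_prop
      simpa using this.tendsto 1
    · filter_upwards [self_mem_nhdsWithin] with q hq
      have : (1:ℝ) < q := hq
      simp only [Set.mem_Ioi]; nlinarith
  have k3 : Tendsto (fun q : ℝ => x * q ^ 3) (𝓝[>] 1) (𝓝[>] x) := by
    apply tendsto_nhdsWithin_of_tendsto_nhds_of_eventually_within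
    · apply Tendsto.mono_left _ nhdsWithin_le_nhds
      have : Continuous (fun q : ℝ => x * q ^ 3) := by fun_prop
      simpa using this.tendsto 1
    · filter_upwards [self_mem_nhdsWithin] with q hq
      have : (1:ℝ) < q := hq
      have : 1 < q ^ 3 := one_lt_pow₀ this (by norm_num)
      simp only [Set.mem_Ioi]; nlinarith
  have hlim : Tendsto (fun q : ℝ => f (x * q ^ 3) - f (x * q)) (𝓝[>] 1) (𝓝 0) := by
    simpa using (hr.comp k3).sub (hr.comp k1)
  rw [Metric.continuousAt_iff']
  intro ε hε
  have e1 : ∀ᶠ q in 𝓝[>] (1:ℝ), f (x * q ^ 3) - f (x * q) < ε := hlim.eventually_lt_const hε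
  have e2 : ∀ᶠ q in 𝓝[>] (1:ℝ), x * q ^ 3 < r :=
    (tendsto_nhds_of_tendsto_nhdsWithin k3).eventually_lt_const hxr
  obtain ⟨q, ⟨hq1, hq2⟩, hq3⟩ := ((e1.and e2).and self_mem_nhdsWithin).exists
  have hq3 : 1 < q := hq3
  have hc := srank_convex h hx0 hq3.le hq2
  have l1 : x / q < x := div_lt_self hx0 hq3
  have l2 : x < x * q := by nlinarith
  have h13 : q ≤ q ^ 3 := le_self_pow₀ hq3.le (by norm_num)
  have l3 : x * q ≤ x * q ^ 3 := mul_le_mul_of_nonneg_left h13 hx0.le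
  have l0 : 0 < x / q := by positivity
  filter_upwards [Ioo_mem_nhds l1 l2] with y hy
  have a1 := hm (a := x / q) ⟨l0, by linarith⟩ (b := y) ⟨by linarith [hy.1], by linarith [hy.2]⟩ hy.1.le
  have a2 := hm (a := y) ⟨by linarith [hy.1], by linarith [hy.2]⟩ (b := x * q) ⟨by linarith, by linarith⟩ hy.2.le
  have a3 := hm (a := x / q) ⟨l0, by linarith⟩ (b := x) ⟨hx0, hxr⟩ l1.le
  have a4 := hm (a := x) ⟨hx0, hxr⟩ (b := x * q) ⟨by linarith, by linarith⟩ l2.le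
  rw [Real.dist_eq, abs_lt]
  constructor <;> linarith

/-! Loewner-type lemma -/

lemma chain_neg : ∀ (n : ℕ) (φ : ℕ → ℝ → ℝ) (δ : ℝ), 0 < δ →
    (∀ k < n, ∀ s ∈ Set.Ico 0 δ, HasDerivAt (φ k) (φ (k + 1) s) s) →
    (∀ k < n, φ k 0 = 0) → ContinuousAt (φ n) 0 → φ n 0 < 0 →
    ∃ η, 0 < η ∧ η ≤ δ ∧ ∀ s ∈ Set.Ioo 0 η, φ 0 s < 0 := by
  intro n
  induction n with
  | zero =>
    intro φ δ hδ _ _ hc hneg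
    obtain ⟨η, hη, hb⟩ := Metric.eventually_nhds_iff.1 (hc.eventually_lt_const hneg)
    refine ⟨min η δ, lt_min hη hδ, min_le_right _ _, fun s hs => hb ?_⟩
    rw [Real.dist_eq, sub_zero, abs_of_pos hs.1]
    exact hs.2.trans_le (min_le_left _ _)
  | succ n ih =>
    intro φ δ hδ hd h0 hc hneg
    obtain ⟨η, hη, hηδ, hb⟩ := ih (fun k => φ (k + 1)) δ hδ
      (fun k hk s hs => hd (k + 1) (by omega) s hs) (fun k hk => h0 (k + 1) (by omega)) hc hneg
    refine ⟨η, hη, hηδ, fun s hs => ?_⟩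
    have : StrictAntiOn (φ 0) (Set.Ico 0 η) := by
      apply strictAntiOn_of_deriv_neg (convex_Ico _ _)
      · intro t ht
        exact (hd 0 (by omega) t ⟨ht.1, ht.2.trans_le hηδ⟩).continuousAt.continuousWithinAt
      · intro t ht
        rw [interior_Ico] at ht
        rw [(hd 0 (by omega) t ⟨ht.1.le, ht.2.trans_le hηδ⟩).deriv]
        exact hb t ht
    have h := this (a := 0) ⟨le_rfl, hη⟩ (b := s) ⟨hs.1.le, hs.2⟩ hs.1
    rwa [h0 0 (by omega)] at h

lemma exists_vec (n : ℕ) : ∃ v : Fin (n + 1) → ℝ,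
    (∀ k < n, ∑ i, v i * (i : ℝ) ^ k = 0) ∧ ∑ i, v i * (i : ℝ) ^ n ≠ 0 := by
  refine ⟨fun i => (((-1 : ℤ) ^ (n - (i : ℕ)) * n.choose i : ℤ) : ℝ), ?_, ?_⟩
  · intro k hk
    have h1 := congrFun (fwdDiff_iter_pow_eq_zero_of_lt (R := ℝ) hk) 0
    rw [fwdDiff_iter_eq_sum_shift, Finset.sum_range] at h1
    simpa [zsmul_eq_mul] using h1
  · have h1 := congrFun (fwdDiff_iter_eq_factorial (R := ℝ) (n := n)) 0
    rw [fwdDiff_iter_eq_sum_shift, Finset.sum_range] at h1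
    have h2 : ∑ i : Fin (n + 1), (((-1 : ℤ) ^ (n - (i : ℕ)) * n.choose i : ℤ) : ℝ) * (i : ℝ) ^ n
      = (n.factorial : ℝ) := by simpa [zsmul_eq_mul] using h1
    rw [h2]
    exact_mod_cast n.factorial_ne_zero

lemma loewner {r : ℝ} (n : ℕ) (F : ℕ → ℝ → ℝ) (hS : SRank r (F 0))
    (hd : ∀ k < n, ∀ x ∈ Set.Ioo 0 r, HasDerivAt (F k) (F (k + 1) x) x)
    (hc : ContinuousOn (F n) (Set.Ioo 0 r)) {a : ℝ} (ha : a ∈ Set.Ioo 0 r) : 0 ≤ F n a := by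
  by_contra hneg
  push Not at hneg
  obtain ⟨v, hv0, hv1⟩ := exists_vec n
  let φ : ℕ → ℝ → ℝ := fun k s => ∑ i : Fin (n + 1), ∑ j : Fin (n + 1),
    v i * v j * (((i : ℝ) * (j : ℝ)) ^ k * F k (a + s * ((i : ℝ) * (j : ℝ))))
  have hφ0 : ∀ k, φ k 0 = (∑ i, v i * (i : ℝ) ^ k) ^ 2 * F k a := by
    intro k
    simp only [φ, zero_mul, add_zero]
    rw [sq, Finset.sum_mul_sum, Finset.sum_mul]
    refine Finset.sum_congr rfl fun i _ => ?_
    rw [Finset.sum_mul]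
    refine Finset.sum_congr rfl fun j _ => ?_
    rw [mul_pow]; ring
  set δ := (r - a) / (n + 1) ^ 2 with hδ
  have hδ0 : 0 < δ := by
    have := sub_pos.2 ha.2
    positivity
  have hmem : ∀ s ∈ Set.Ico 0 δ, ∀ i j : Fin (n + 1),
      a + s * ((i : ℝ) * (j : ℝ)) ∈ Set.Ioo 0 r := by
    intro s hs i j
    have h1 : (i : ℝ) ≤ n + 1 := by exact_mod_cast i.2.le
    have h2 : (j : ℝ) ≤ n + 1 := by exact_mod_cast j.2.le
    have h3 : (i : ℝ) * (j : ℝ) ≤ (n + 1) ^ 2 := by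
      rw [sq]; exact mul_le_mul h1 h2 (by positivity) (by positivity)
    have h4 : s * (n + 1) ^ 2 < r - a := by
      have := hs.2
      rwa [hδ, lt_div_iff₀ (by positivity)] at this
    have h5 := mul_le_mul_of_nonneg_left h3 hs.1
    have h6 : 0 ≤ s * ((i : ℝ) * (j : ℝ)) := mul_nonneg hs.1 (by positivity)
    exact ⟨by linarith [ha.1], by linarith⟩
  obtain ⟨η, hη, hηδ, hb⟩ := chain_neg n φ δ hδ0
    (by
      intro k hk s hs
      simp only [φ]
      apply HasDerivAt.fun_sum
      intro i _
      apply HasDerivAt.fun_sum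
      intro j _
      have h1 := hd k hk _ (hmem s hs i j)
      have h2 : HasDerivAt (fun s : ℝ => a + s * ((i : ℝ) * (j : ℝ))) ((i : ℝ) * (j : ℝ)) s := by
        simpa using ((hasDerivAt_id s).mul_const ((i : ℝ) * (j : ℝ))).const_add a
      have h3 := ((HasDerivAt.comp s h1 h2).const_mul (((i : ℝ) * (j : ℝ)) ^ k)).const_mul (v i * v j)
      refine HasDerivAt.congr_deriv h3 ?_
      ring)
    (by intro k hk; rw [hφ0, hv0 k hk]; simp)
    (by
      simp only [φ]
      apply tendsto_finsetSum
      intro i _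
      apply tendsto_finsetSum
      intro j _
      apply Tendsto.const_mul
      apply Tendsto.const_mul
      have hca : ContinuousAt (F n) (a + 0 * ((i : ℝ) * (j : ℝ))) := by
        rw [zero_mul, add_zero]
        exact hc.continuousAt (Ioo_mem_nhds ha.1 ha.2)
      have : ContinuousAt (fun s : ℝ => a + s * ((i : ℝ) * (j : ℝ))) 0 := by fun_prop
      exact ContinuousAt.comp (f := fun s : ℝ => a + s * ((i : ℝ) * (j : ℝ))) hca this)
    (by rw [hφ0]; exact mul_neg_of_pos_of_neg (by positivity) hneg)
  have hs : η / 2 ∈ Set.Ioo 0 η := ⟨by linarith, by linarith⟩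
  have h1 := hb _ hs
  have hsq : √(η / 2) * √(η / 2) = η / 2 := Real.mul_self_sqrt (by linarith)
  have he : ∀ i j : Fin (n + 1), a + (√(η / 2) * (i : ℝ)) * (√(η / 2) * (j : ℝ))
      = a + η / 2 * ((i : ℝ) * (j : ℝ)) := by
    intro i j
    rw [← hsq]; ring_nf
    simp
  have h2 := hS (n + 1) a (fun i => √(η / 2) * (i : ℝ)) v ha.1.le (by
    intro i j
    rw [he]
    exact hmem _ ⟨hs.1.le, hs.2.trans_le hηδ⟩ i j)
  simp only [he] at h2
  simp only [φ, pow_zero, one_mul] at h1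
  linarith

/-! Smoothing -/

/-- Box smoothing. -/
noncomputable def boxT (h : ℝ) (f : ℝ → ℝ) : ℝ → ℝ := fun x => ∫ t in (0:ℝ)..h, f (x + t)

lemma boxT_deriv {r h : ℝ} (hh : 0 < h) {f : ℝ → ℝ} (hc : ContinuousOn f (Set.Ioo 0 r)) {x : ℝ}
    (hx : x ∈ Set.Ioo 0 (r - h)) : HasDerivAt (boxT h f) (fwdDiff h f x) x := by
  have hxr : x ∈ Set.Ioo 0 r := ⟨hx.1, by linarith [hx.2]⟩
  have hxh : x + h ∈ Set.Ioo 0 r := ⟨by linarith [hx.1], by linarith [hx.2]⟩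
  have hint : ∀ p ∈ Set.Ioo 0 r, ∀ q ∈ Set.Ioo 0 r,
      IntervalIntegrable f MeasureTheory.volume p q := by
    intro p hp q hq
    apply ContinuousOn.intervalIntegrable
    exact hc.mono (Set.OrdConnected.uIcc_subset Set.ordConnected_Ioo hp hq)
  have key : ∀ p ∈ Set.Ioo 0 r, HasDerivAt (fun u => ∫ t in x..u, f t) (f p) p := by
    intro p hp
    exact intervalIntegral.integral_hasDerivAt_right (hint x hxr p hp)
      (hc.stronglyMeasurableAtFilter isOpen_Ioo p hp) (hc.continuousAt (Ioo_mem_nhds hp.1 hp.2))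
  have h1 := (HasDerivAt.comp_add_const x h (key _ hxh)).sub (key x hxr)
  refine h1.congr_of_eventuallyEq ?_
  filter_upwards [Ioo_mem_nhds hx.1 hx.2] with y hy
  have hyr : y ∈ Set.Ioo 0 r := ⟨hy.1, by linarith [hy.2]⟩
  have hyh : y + h ∈ Set.Ioo 0 r := ⟨by linarith [hy.1], by linarith [hy.2]⟩
  simp only [boxT, Pi.sub_apply]
  rw [intervalIntegral.integral_interval_sub_left (hint _ hxr _ hyh) (hint _ hxr _ hyr)]
  rw [intervalIntegral.integral_comp_add_left]
  simp

lemma boxT_cont {r h : ℝ} (hh : 0 < h) {f : ℝ → ℝ} (hc : ContinuousOn f (Set.Ioo 0 r)) :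
    ContinuousOn (boxT h f) (Set.Ioo 0 (r - h)) := fun _ hx =>
  (boxT_deriv hh hc hx).continuousAt.continuousWithinAt

lemma boxT_srank {r h : ℝ} (hh : 0 < h) {f : ℝ → ℝ} (hc : ContinuousOn f (Set.Ioo 0 r))
    (hS : SRank r f) : SRank (r - h) (boxT h f) := by
  intro n a u v ha hu
  have hmem : ∀ i j, ∀ t ∈ Set.Icc 0 h, a + u i * u j + t ∈ Set.Ioo 0 r := by
    intro i j t ht
    exact ⟨by linarith [(hu i j).1, ht.1], by linarith [(hu i j).2, ht.2]⟩
  have hint : ∀ i j, IntervalIntegrable (fun t => v i * v j * f (a + u i * u j + t))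
      MeasureTheory.volume 0 h := by
    intro i j
    apply ContinuousOn.intervalIntegrable
    rw [Set.uIcc_of_le hh.le]
    apply ContinuousOn.mul continuousOn_const
    exact hc.comp (by fun_prop) (fun t ht => hmem i j t ht)
  have : ∑ i, ∑ j, v i * v j * boxT h f (a + u i * u j)
      = ∫ t in (0:ℝ)..h, ∑ i, ∑ j, v i * v j * f (a + u i * u j + t) := by
    rw [intervalIntegral.integral_finsetSum]
    · refine Finset.sum_congr rfl fun i _ => ?_
      rw [intervalIntegral.integral_finsetSum]
      · refine Finset.sum_congr rfl fun j _ => ?_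
        rw [intervalIntegral.integral_const_mul]; rfl
      · intro j _; exact hint i j
    · intro i _
      have := IntervalIntegrable.sum Finset.univ (fun j _ => hint i j)
      have e : (∑ j, fun t => v i * v j * f (a + u i * u j + t))
          = fun t => ∑ j, v i * v j * f (a + u i * u j + t) := by
        ext t; simp
      rwa [e] at this
  rw [this]
  apply intervalIntegral.integral_nonneg hh.le
  intro t ht
  have := hS n (a + t) u v (by linarith [ht.1]) (by
    intro i j
    have := hmem i j t ht
    rwa [show a + t + u i * u j = a + u i * u j + t by ring])
  simpa only [show ∀ i j, a + t + u i * u j = a + u i * u j + t from fun i j => by ring] using this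

lemma boxT_iter {r h : ℝ} (hh : 0 < h) {f : ℝ → ℝ} (hS : SRank r f) (j : ℕ) :
    SRank (r - j * h) ((boxT h)^[j] f) ∧
      ContinuousOn ((boxT h)^[j] f) (Set.Ioo 0 (r - j * h)) := by
  have : SRank (r - j * h) ((boxT h)^[j] f) := by
    induction j with
    | zero => simpa using hS
    | succ j ih =>
      rw [Function.iterate_succ_apply']
      have := boxT_srank hh (srank_cont ih) ih
      convert this using 1
      push_cast; ring
  exact ⟨this, srank_cont this⟩

lemma fwdDiff_iter_hasDerivAt {h : ℝ} {g g' : ℝ → ℝ} (k : ℕ) {x : ℝ}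
    (hd : ∀ i ≤ k, HasDerivAt g (g' (x + i * h)) (x + i * h)) :
    HasDerivAt ((fwdDiff h)^[k] g) ((fwdDiff h)^[k] g' x) x := by
  have : (fwdDiff h)^[k] g = fun y => ∑ i ∈ Finset.range (k + 1),
      ((-1 : ℤ) ^ (k - i) * k.choose i) • g (y + i • h) := by
    ext y; rw [fwdDiff_iter_eq_sum_shift]
  rw [this, fwdDiff_iter_eq_sum_shift]
  apply HasDerivAt.fun_sum
  intro i hi
  have h1 := hd i (by simpa [Nat.lt_succ_iff] using hi)
  rw [nsmul_eq_mul]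
  simp only [zsmul_eq_mul]
  exact (HasDerivAt.comp_add_const x (i * h) h1).const_mul _

lemma fwdDiff_iter_cont {h r : ℝ} (hh : 0 < h) {g : ℝ → ℝ} (k : ℕ)
    (hg : ContinuousOn g (Set.Ioo 0 r)) :
    ContinuousOn ((fwdDiff h)^[k] g) (Set.Ioo 0 (r - k * h)) := by
  have : (fwdDiff h)^[k] g = fun y => ∑ i ∈ Finset.range (k + 1),
      ((-1 : ℤ) ^ (k - i) * k.choose i) • g (y + i • h) := by
    ext y; rw [fwdDiff_iter_eq_sum_shift]
  rw [this]
  apply continuousOn_finsetSum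
  intro i hi
  have hi' : (i : ℝ) ≤ k := by
    exact_mod_cast (by simpa [Nat.lt_succ_iff] using hi)
  simp only [zsmul_eq_mul, nsmul_eq_mul]
  apply ContinuousOn.mul continuousOn_const
  apply hg.comp (by fun_prop)
  intro y hy
  have := mul_le_mul_of_nonneg_right hi' hh.le
  have h0 : 0 ≤ (i : ℝ) * h := by positivity
  exact ⟨by linarith [hy.1], by linarith [hy.2]⟩

lemma srank_fwdDiff {r h : ℝ} (hh : 0 < h) {f : ℝ → ℝ} (hS : SRank r f) (n : ℕ) {x : ℝ}
    (hx : 0 < x) (hxr : x + n * h < r) : 0 ≤ (fwdDiff h)^[n] f x := by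
  have := loewner (r := r - n * h) n (fun k => (fwdDiff h)^[k] ((boxT h)^[n - k] f))
    (by simpa using (boxT_iter hh hS n).1)
    (by
      intro k hk y hy
      obtain ⟨m, rfl⟩ : ∃ m, n = k + (m + 1) := ⟨n - k - 1, by omega⟩
      have e1 : k + (m + 1) - k = m + 1 := by omega
      have e2 : k + (m + 1) - (k + 1) = m := by omega
      simp only [e1, e2]
      rw [Function.iterate_succ_apply (fwdDiff h) k, Function.iterate_succ_apply' (boxT h) m]
      apply fwdDiff_iter_hasDerivAt
      intro i hi
      have hi' : (i : ℝ) ≤ k := by exact_mod_cast hi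
      have := mul_le_mul_of_nonneg_right hi' hh.le
      have h0 : 0 ≤ (i : ℝ) * h := by positivity
      apply boxT_deriv hh (boxT_iter hh hS m).2
      have := hy.2
      push_cast at this
      exact ⟨by linarith [hy.1], by linarith⟩)
    (by simpa using fwdDiff_iter_cont hh n (srank_cont hS))
    (a := x) ⟨hx, by linarith⟩
  simpa using this

/-! Bernstein -/

/-- Forward difference as a linear map. -/
def fwdD (h : ℝ) : Module.End ℝ (ℝ → ℝ) where
  toFun := fwdDiff h
  map_add' := fwdDiff_add h
  map_smul' := fwdDiff_const_smul h

lemma fwdD_pow (h : ℝ) (k : ℕ) (g : ℝ → ℝ) : (fwdD h ^ k) g = (fwdDiff h)^[k] g := by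
  rw [Module.End.pow_apply]; rfl

lemma shift_pow (h : ℝ) (k : ℕ) (g : ℝ → ℝ) (y : ℝ) :
    ((fwdD h + 1) ^ k) g y = g (y + k * h) := by
  induction k generalizing g y with
  | zero => simp
  | succ k ih =>
    rw [pow_succ, Module.End.mul_apply, ih]
    simp only [LinearMap.add_apply, Module.End.one_apply, Pi.add_apply]
    change (g (y + k * h + h) - g (y + k * h)) + g (y + k * h) = _
    push_cast
    ring_nf

lemma bern_id (h x : ℝ) (n : ℕ) (g : ℝ → ℝ) (y : ℝ) :
    ∑ j ∈ Finset.range (n + 1), ((n.choose j : ℝ) * x ^ j * (1 - x) ^ (n - j)) * g (y + j * h)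
      = ∑ k ∈ Finset.range (n + 1), ((n.choose k : ℝ) * (fwdDiff h)^[k] g y) * x ^ k := by
  have e : x • (fwdD h + 1) + (1 - x) • (1 : Module.End ℝ (ℝ → ℝ)) = x • fwdD h + 1 := by
    module
  have h1 : (x • (fwdD h + 1) + (1 - x) • (1 : Module.End ℝ (ℝ → ℝ))) ^ n
      = ∑ j ∈ Finset.range (n + 1), ((n.choose j : ℝ) * x ^ j * (1 - x) ^ (n - j)) •
        (fwdD h + 1) ^ j := by
    rw [Commute.add_pow ((Commute.one_right _).smul_right _)]
    refine Finset.sum_congr rfl fun j _ => ?_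
    rw [smul_pow, smul_pow, one_pow, mul_smul_comm, mul_one, smul_smul]
    rw [← (Nat.cast_commute (n.choose j) _).eq, ← nsmul_eq_mul, ← Nat.cast_smul_eq_nsmul ℝ,
      smul_smul]
    congr 1; ring
  have h2 : (x • fwdD h + 1) ^ n
      = ∑ j ∈ Finset.range (n + 1), ((n.choose j : ℝ) * x ^ j) • (fwdD h) ^ j := by
    rw [Commute.add_pow (Commute.one_right _)]
    refine Finset.sum_congr rfl fun j _ => ?_
    rw [smul_pow, one_pow, mul_one]
    rw [← (Nat.cast_commute (n.choose j) _).eq, ← nsmul_eq_mul, ← Nat.cast_smul_eq_nsmul ℝ,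
      smul_smul]
  rw [e, h2] at h1
  have h3 := congrFun (LinearMap.congr_fun h1 g) y
  simp only [LinearMap.sum_apply, LinearMap.smul_apply, Finset.sum_apply, Pi.smul_apply,
    smul_eq_mul, fwdD_pow, shift_pow] at h3
  rw [← h3]
  exact Finset.sum_congr rfl fun k _ => by ring

/-- Bernstein: nonnegative differences imply power series. -/
lemma bern_series {g : ℝ → ℝ} (hc : ContinuousOn g (Set.Icc 0 1))
    (hg : ∀ n : ℕ, 0 < n → ∀ k ≤ n, 0 ≤ (fwdDiff (1 / (n : ℝ)))^[k] g 0) :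
    ∃ a : ℕ → ℝ, (∀ k, 0 ≤ a k) ∧ ∀ t ∈ Set.Ico (0:ℝ) 1, HasSum (fun k => a k * t ^ k) (g t) := by
  let c : ℕ → ℕ → ℝ := fun n k => (n.choose k : ℝ) * (fwdDiff (1 / (n : ℝ)))^[k] g 0
  have hc0 : ∀ n, 0 < n → ∀ k, 0 ≤ c n k := by
    intro n hn k
    by_cases hk : k ≤ n
    · exact mul_nonneg (by positivity) (hg n hn k hk)
    · simp [c, Nat.choose_eq_zero_of_lt (not_le.1 hk)]
  have hsumc : ∀ n, 0 < n → ∑ k ∈ Finset.range (n + 1), c n k = g 1 := by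
    intro n hn
    have h1 := bern_id (1 / (n : ℝ)) 1 n g 0
    rw [Finset.sum_range_succ] at h1
    rw [Finset.sum_eq_zero] at h1
    · have hn' : (n : ℝ) ≠ 0 := by positivity
      simp only [Nat.choose_self, Nat.cast_one, one_pow, sub_self, Nat.sub_self, pow_zero,
        mul_one, zero_add, one_mul, mul_one_div_cancel hn'] at h1
      exact h1.symm
    · intro j hj
      have hj : j < n := by simpa using hj
      rw [sub_self, zero_pow (by omega)]; simp
  have hc1 : ∀ n, 0 < n → ∀ k, c n k ≤ g 1 := by
    intro n hn k
    rw [← hsumc n hn]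
    by_cases hk : k ≤ n
    · exact Finset.single_le_sum (f := c n) (fun i _ => hc0 n hn i) (by simpa [Nat.lt_succ_iff] using hk)
    · have : c n k = 0 := by simp [c, Nat.choose_eq_zero_of_lt (not_le.1 hk)]
      rw [this]
      exact Finset.sum_nonneg (fun i _ => hc0 n hn i)
  -- Bernstein convergence
  have hB : ∀ t ∈ Set.Icc (0:ℝ) 1,
      Tendsto (fun n => ∑' k, c n k * t ^ k) atTop (𝓝 (g t)) := by
    intro t ht
    let G : C(unitInterval, ℝ) := ⟨fun x => g x, continuousOn_iff_continuous_domRestrict.1 hc⟩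
    have h1 := bernsteinApproximation_uniform G
    have h2 : Tendsto (fun n => bernsteinApproximation n G ⟨t, ht⟩) atTop (𝓝 (G ⟨t, ht⟩)) :=
      ((continuous_eval_const (⟨t, ht⟩ : unitInterval)).tendsto G).comp h1
    refine h2.congr ?_
    intro n
    rw [tsum_eq_sum (s := Finset.range (n + 1))]
    · rw [← bern_id, bernsteinApproximation.apply, Finset.sum_range]
      refine Finset.sum_congr rfl fun j _ => ?_
      rw [bernstein_apply, smul_eq_mul]
      congr 1
      change g ((j : ℝ) / n) = _
      congr 1
      ring
    · intro k hk
      have : n < k := by simpa [Nat.lt_succ_iff] using hk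
      simp [c, Nat.choose_eq_zero_of_lt this]
  let U : Ultrafilter ℕ := Filter.hyperfilter ℕ
  have hU : (U : Filter ℕ) ≤ atTop := by
    rw [← Nat.cofinite_eq_atTop]; exact Filter.hyperfilter_le_cofinite
  have hpos : ∀ᶠ n in (U : Filter ℕ), 0 < n := hU (eventually_gt_atTop 0)
  have hex : ∀ k, ∃ b ∈ Set.Icc 0 (g 1), Tendsto (fun n => c n k) U (𝓝 b) := by
    intro k
    have := isCompact_Icc.ultrafilter_le_nhds (s := Set.Icc 0 (g 1)) (U.map (fun n => c n k)) (by
      rw [Filter.le_principal_iff]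
      change ∀ᶠ n in (U : Filter ℕ), c n k ∈ Set.Icc 0 (g 1)
      filter_upwards [hpos] with n hn using ⟨hc0 n hn k, hc1 n hn k⟩)
    exact this
  choose a ha ha2 using hex
  refine ⟨a, fun k => (ha k).1, fun t ht => ?_⟩
  have hsg : Summable (fun k : ℕ => g 1 * t ^ k) :=
    (summable_geometric_of_lt_one ht.1 ht.2).mul_left _
  have hs : Summable (fun k => a k * t ^ k) := by
    refine Summable.of_nonneg_of_le (fun k => mul_nonneg (ha k).1 (pow_nonneg ht.1 k)) ?_ hsg
    intro k
    exact mul_le_mul_of_nonneg_right (ha k).2 (pow_nonneg ht.1 k)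
  have h1 : Tendsto (fun n => ∑' k, c n k * t ^ k) U (𝓝 (∑' k, a k * t ^ k)) := by
    refine tendsto_tsum_of_dominated_convergence hsg (fun k => (ha2 k).mul_const _) ?_
    filter_upwards [hpos] with n hn k
    rw [Real.norm_eq_abs, abs_of_nonneg (mul_nonneg (hc0 n hn k) (pow_nonneg ht.1 k))]
    exact mul_le_mul_of_nonneg_right (hc1 n hn k) (pow_nonneg ht.1 k)
  have h2 := tendsto_nhds_unique h1 ((hB t ⟨ht.1, ht.2.le⟩).mono_left hU)
  rw [← h2]
  exact hs.hasSum

lemma fwdDiff_iter_affine (f : ℝ → ℝ) (c L h : ℝ) (k : ℕ) (x : ℝ) :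
    (fwdDiff h)^[k] (fun t => f (c + L * t)) x = (fwdDiff (L * h))^[k] f (c + L * x) := by
  rw [fwdDiff_iter_eq_sum_shift, fwdDiff_iter_eq_sum_shift]
  refine Finset.sum_congr rfl fun i _ => ?_
  congr 2
  simp only [nsmul_eq_mul]; ring

lemma bern_series' {f : ℝ → ℝ} {r c L : ℝ} (hc : 0 < c) (hL : 0 < L) (hcL : c + L < r)
    (hcont : ContinuousOn f (Set.Ioo 0 r))
    (hf : ∀ h > 0, ∀ n : ℕ, ∀ x > 0, x + n * h < r → 0 ≤ (fwdDiff h)^[n] f x) :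
    ∃ a : ℕ → ℝ, (∀ k, 0 ≤ a k) ∧ ∀ t ∈ Set.Ico (0:ℝ) L, HasSum (fun k => a k * t ^ k) (f (c + t)) := by
  obtain ⟨a, ha, hs⟩ := bern_series (g := fun t => f (c + L * t))
    (by
      apply hcont.comp (by fun_prop)
      intro t ht
      have h1 := mul_le_mul_of_nonneg_left ht.2 hL.le
      have h2 := mul_nonneg hL.le ht.1
      exact ⟨by linarith, by linarith⟩)
    (by
      intro n hn k hk
      rw [fwdDiff_iter_affine]
      have hn' : (0:ℝ) < n := by exact_mod_cast hn
      have hk' : (k:ℝ) ≤ n := by exact_mod_cast hk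
      apply hf _ (by positivity) _ _ (by simpa using hc)
      have : (k:ℝ) * (L * (1 / n)) ≤ L := by
        rw [mul_one_div, mul_div_assoc', div_le_iff₀ hn', mul_comm]
        exact mul_le_mul_of_nonneg_left hk' hL.le
      linarith)
  refine ⟨fun k => a k / L ^ k, fun k => div_nonneg (ha k) (by positivity), fun t ht => ?_⟩
  have := hs (t / L) ⟨div_nonneg ht.1 hL.le, (div_lt_one hL).2 ht.2⟩
  rw [mul_div_cancel₀ _ hL.ne'] at this
  convert this using 2 with k
  rw [div_pow]; ring

lemma chain_fwdDiff {h : ℝ} (hh : 0 < h) (n : ℕ) : ∀ (r : ℝ) (F : ℕ → ℝ → ℝ),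
    (∀ k, ∀ x ∈ Set.Ioo 0 r, HasDerivAt (F k) (F (k + 1) x) x) →
    (∀ k, ∀ x ∈ Set.Ioo 0 r, 0 ≤ F k x) →
    ∀ x > 0, x + n * h < r → 0 ≤ (fwdDiff h)^[n] (F 0) x := by
  induction n with
  | zero =>
    intro r F _ h0 x hx hxr
    exact h0 0 x ⟨hx, by simpa using hxr⟩
  | succ n ih =>
    intro r F hd h0 x hx hxr
    rw [Function.iterate_succ_apply]
    push_cast at hxr
    refine ih (r - h) (fun k => fwdDiff h (F k)) ?_ ?_ x hx (by linarith)
    · intro k x hx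
      exact (HasDerivAt.comp_add_const x h
        (hd k (x + h) ⟨by linarith [hx.1], by linarith [hx.2]⟩)).sub
        (hd k x ⟨hx.1, by linarith [hx.2]⟩)
    · intro k x hx
      have hm : MonotoneOn (F k) (Set.Ioo 0 r) := by
        apply monotoneOn_of_deriv_nonneg (convex_Ioo _ _)
        · intro y hy; exact (hd k y hy).continuousAt.continuousWithinAt
        · intro y hy
          rw [interior_Ioo] at hy
          exact (hd k y hy).differentiableAt.differentiableWithinAt
        · intro y hy
          rw [interior_Ioo] at hy
          rw [(hd k y hy).deriv]; exact h0 _ _ hy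
      exact sub_nonneg.2 (hm ⟨hx.1, by linarith [hx.2]⟩
        ⟨by linarith [hx.1], by linarith [hx.2]⟩ (by linarith))

lemma series_analytic {f : ℝ → ℝ} {c L : ℝ} {a : ℕ → ℝ} (ha : ∀ k, 0 ≤ a k)
    (hs : ∀ t ∈ Set.Ico (0:ℝ) L, HasSum (fun k => a k * t ^ k) (f (c + t))) {x : ℝ}
    (hx : x ∈ Set.Ioo c (c + L)) : AnalyticAt ℝ f x := by
  let p := FormalMultilinearSeries.ofScalars ℝ a
  obtain ⟨l, hl1, hl2⟩ := exists_between hx.2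
  have hl0 : 0 < l - c := by linarith [hx.1]
  have hrad : ENNReal.ofReal (l - c) ≤ p.radius := by
    apply FormalMultilinearSeries.le_radius_of_summable
    rw [Real.coe_toNNReal _ hl0.le]
    have := (hs (l - c) ⟨hl0.le, by linarith⟩).summable
    refine Summable.of_nonneg_of_le (fun k => by positivity) ?_ this
    intro k
    apply mul_le_mul_of_nonneg_right _ (by positivity)
    simp [p, abs_of_nonneg (ha k)]
  have hpos : 0 < p.radius := (ENNReal.ofReal_pos.2 hl0).trans_le hrad
  have h1 := p.hasFPowerSeriesOnBall hpos
  have h2 : AnalyticAt ℝ p.sum (x - c) := by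
    apply h1.analyticAt_of_mem
    rw [Metric.mem_eball, edist_dist]
    refine lt_of_lt_of_le ?_ hrad
    rw [Real.dist_eq, sub_zero, abs_of_pos (by linarith [hx.1])]
    exact (ENNReal.ofReal_lt_ofReal_iff hl0).2 (by linarith)
  have h3 : AnalyticAt ℝ (fun y => p.sum (y - c)) x :=
    AnalyticAt.fun_comp (g := p.sum) (f := fun y => y - c) h2 (by fun_prop)
  refine h3.congr ?_
  filter_upwards [Ioo_mem_nhds hx.1 hx.2] with y hy
  have h4 := (hs (y - c) ⟨by linarith [hy.1], by linarith [hy.2]⟩).tsum_eq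
  rw [add_sub_cancel] at h4
  rw [← h4]
  simp [p, FormalMultilinearSeries.sum, mul_comm]

lemma psd_iff {n : ℕ} (A : Matrix (Fin n) (Fin n) ℝ) :
    A.PosSemidef ↔ A.IsHermitian ∧ ∀ v : Fin n → ℝ, 0 ≤ ∑ i, ∑ j, v i * v j * A i j := by
  rw [Matrix.posSemidef_iff_dotProduct_mulVec]
  refine and_congr_right fun _ => forall_congr' fun v => ?_
  have : star v ⬝ᵥ (A *ᵥ v) = ∑ i, ∑ j, v i * v j * A i j := by
    simp only [dotProduct, mulVec, Finset.mul_sum]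
    refine Finset.sum_congr rfl fun i _ => Finset.sum_congr rfl fun j _ => ?_
    simp; ring
  rw [this]

lemma psd_pow {n : ℕ} {A : Matrix (Fin n) (Fin n) ℝ} (hA : A.PosSemidef) (k : ℕ) :
    (A.map (fun x => x ^ k)).PosSemidef := by
  induction k with
  | zero =>
    rw [psd_iff]
    refine ⟨by ext i j; simp, fun v => ?_⟩
    have : ∑ i, ∑ j, v i * v j * (A.map (fun x => x ^ 0)) i j = (∑ i, v i) ^ 2 := by
      rw [sq, Finset.sum_mul_sum]
      simp
    rw [this]; positivity
  | succ k ih =>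
    have : A.map (fun x => x ^ (k + 1)) = Matrix.hadamard (A.map (fun x => x ^ k)) A := by
      ext i j; simp [pow_succ]
    rw [this]
    exact ih.hadamard hA

lemma deriv_chain {f : ℝ → ℝ} {I : Set ℝ} (hI : IsOpen I) (hf : ContDiffOn ℝ (⊤ : ℕ∞) f I) (k : ℕ)
    {x : ℝ} (hx : x ∈ I) :
    HasDerivAt (iteratedDerivWithin k f I) (iteratedDerivWithin (k + 1) f I x) x := by
  rw [iteratedDerivWithin_succ]
  have h1 := hf.differentiableOn_iteratedDerivWithin (m := k)
    (by exact_mod_cast WithTop.coe_lt_top (k : ℕ)) hI.uniqueDiffOn x hx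
  exact h1.hasDerivWithinAt.hasDerivAt (hI.mem_nhds hx)

lemma three_two {R : EReal} {I : Set ℝ} (hI : I = {x : ℝ | 0 < x ∧ (x : EReal) < R}) (hIo : IsOpen I)
    {f : ℝ → ℝ} (hf : AbsolutelyMonotonicOn f I) :
    ∀ n : ℕ, 1 ≤ n → ∀ A : Matrix (Fin n) (Fin n) ℝ, A.PosSemidef →
        (∀ i j, A i j ∈ I) → (A.map f).PosSemidef := by
  intro n hn A hA hAI
  obtain ⟨hcont, hsm, hnn⟩ := hf
  rw [hIo.interior_eq] at hsm hnn
  haveI : Nonempty (Fin n × Fin n) := ⟨⟨⟨0, hn⟩, ⟨0, hn⟩⟩⟩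
  obtain ⟨⟨i0, j0⟩, hmax⟩ := Finite.exists_max (fun p : Fin n × Fin n => A p.1 p.2)
  set M := A i0 j0 with hM
  have hMI : M ∈ I := hAI i0 j0
  have hApos : ∀ i j, 0 < A i j := fun i j => by
    have := hAI i j; rw [hI] at this; exact this.1
  rw [hI] at hMI
  obtain ⟨r, hr1, hr2⟩ := EReal.lt_iff_exists_real_btwn.1 hMI.2
  have hr1 : M < r := by exact_mod_cast hr1
  have hsub : Set.Ioo 0 r ⊆ I := by
    intro x hx
    rw [hI]
    exact ⟨hx.1, lt_trans (by exact_mod_cast hx.2) hr2⟩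
  have hdiff : ∀ h > 0, ∀ n : ℕ, ∀ x > 0, x + n * h < r → 0 ≤ (fwdDiff h)^[n] f x := by
    intro h hh n x hx hxr
    have := chain_fwdDiff hh n r (fun k => iteratedDerivWithin k f I)
      (fun k x hx => deriv_chain hIo hsm k (hsub hx)) (fun k x hx => hnn k x (hsub hx)) x hx hxr
    rwa [iteratedDerivWithin_zero] at this
  have hApow := fun k => ((psd_iff _).1 (psd_pow hA k)).2
  rw [psd_iff]
  have hsymm := hA.isHermitian
  refine ⟨by
    ext i j
    have := hsymm.apply i j
    simp only [star_trivial] at this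
    simp [this], fun v => ?_⟩
  have hlim : Tendsto (fun c => ∑ i, ∑ j, v i * v j * f (c + A i j)) (𝓝[>] 0)
      (𝓝 (∑ i, ∑ j, v i * v j * A.map f i j)) := by
    apply tendsto_finsetSum
    intro i _
    apply tendsto_finsetSum
    intro j _
    apply Tendsto.const_mul
    rw [Matrix.map_apply]
    have h1 : ContinuousAt f (0 + A i j) := by
      rw [zero_add]
      exact hcont.continuousAt (hIo.mem_nhds (hAI i j))
    have h2 : ContinuousAt (fun c => f (c + A i j)) 0 :=
      ContinuousAt.comp (f := fun c => c + A i j) h1 (by fun_prop)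
    have h3 := h2.tendsto.mono_left (nhdsWithin_le_nhds (s := Set.Ioi 0))
    simpa using h3
  refine ge_of_tendsto hlim ?_
  have hpos : 0 < (r - M) / 2 := by linarith
  filter_upwards [Ioo_mem_nhdsGT hpos] with c hc
  obtain ⟨a, ha, hs⟩ := bern_series' (r := r) (c := c) (L := (r + M) / 2) hc.1
    (by linarith [hMI.1]) (by linarith [hc.2]) (hcont.mono hsub) hdiff
  have hsum : HasSum (fun k => ∑ i, ∑ j, v i * v j * (a k * A i j ^ k))
      (∑ i, ∑ j, v i * v j * f (c + A i j)) := by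
    apply hasSum_sum
    intro i _
    apply hasSum_sum
    intro j _
    apply HasSum.mul_left
    exact hs _ ⟨(hApos i j).le, by have := hmax (i, j); simp only at this; linarith⟩
  refine hsum.nonneg fun k => ?_
  have : ∑ i, ∑ j, v i * v j * (a k * A i j ^ k)
      = a k * ∑ i, ∑ j, v i * v j * (A.map (fun x => x ^ k)) i j := by
    simp only [Finset.mul_sum]
    refine Finset.sum_congr rfl fun i _ => Finset.sum_congr rfl fun j _ => ?_
    simp; ring
  rw [this]
  exact mul_nonneg (ha k) (hApow k v)

lemma one_three {R : EReal} {I : Set ℝ} (hI : I = {x : ℝ | 0 < x ∧ (x : EReal) < R}) (hIo : IsOpen I)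
    {f : ℝ → ℝ} (hf : ∀ n : ℕ, 1 ≤ n → ∀ a : ℝ, 0 ≤ a → (a : EReal) < R → ∀ u : Fin n → ℝ,
        (∀ i j, a + u i * u j ∈ I) →
        (Matrix.of fun i j => f (a + u i * u j)).PosSemidef) : AbsolutelyMonotonicOn f I := by
  have hS : ∀ r : ℝ, (r : EReal) < R → SRank r f := by
    intro r hr n a u v ha hu
    rcases Nat.eq_zero_or_pos n with rfl | hn
    · simp
    have haR : (a : EReal) < R := by
      have h1 := (hu ⟨0, hn⟩ ⟨0, hn⟩).2
      have h2 : a < r := by nlinarith [mul_self_nonneg (u ⟨0, hn⟩)]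
      exact lt_trans (by exact_mod_cast h2) hr
    have := hf n hn a ha haR u (by
      intro i j
      rw [hI]
      exact ⟨(hu i j).1, lt_trans (by exact_mod_cast (hu i j).2) hr⟩)
    exact ((psd_iff _).1 this).2 v
  have hr : ∀ x ∈ I, ∃ r : ℝ, x ∈ Set.Ioo 0 r ∧ (r : EReal) < R ∧ Set.Ioo 0 r ⊆ I := by
    intro x hx
    rw [hI] at hx
    obtain ⟨r, hr1, hr2⟩ := EReal.lt_iff_exists_real_btwn.1 hx.2
    refine ⟨r, ⟨hx.1, by exact_mod_cast hr1⟩, hr2, fun y hy => ?_⟩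
    rw [hI]
    exact ⟨hy.1, lt_trans (by exact_mod_cast hy.2) hr2⟩
  have han : ∀ x ∈ I, AnalyticAt ℝ f x := by
    intro x hx
    obtain ⟨r, hxr, hrR, -⟩ := hr x hx
    have h1 := hS r hrR
    have hL : 0 < r / 2 := by linarith [hxr.1, hxr.2]
    obtain ⟨y, hy1, hy2⟩ := exists_between hxr.2
    have hx0 := hxr.1
    obtain ⟨a, ha, hs⟩ := bern_series' (f := f) (r := r) (c := x / 2) (L := y - x / 2)
      (by linarith) (by linarith) (by linarith) (srank_cont h1)
      (fun h hh n z hz hzr => srank_fwdDiff hh h1 n hz hzr)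
    exact series_analytic (c := x / 2) (L := y - x / 2) ha hs
      ⟨by linarith, by linarith⟩
  have hsm : ContDiffOn ℝ (⊤ : ℕ∞) f I := fun x hx => (han x hx).contDiffAt.contDiffWithinAt
  refine ⟨hsm.continuousOn, by rwa [hIo.interior_eq], ?_⟩
  rw [hIo.interior_eq]
  intro k x hx
  obtain ⟨r, hxr, hrR, hsub⟩ := hr x hx
  exact loewner (r := r) k (fun k => iteratedDerivWithin k f I)
    (by simpa [iteratedDerivWithin_zero] using hS r hrR)
    (fun k _ y hy => deriv_chain hIo hsm k (hsub hy))
    (fun y hy => (deriv_chain hIo hsm k (hsub hy)).continuousAt.continuousWithinAt) hxr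

lemma two_one {R : EReal} {I : Set ℝ}
    {f : ℝ → ℝ} (hf : ∀ n : ℕ, 1 ≤ n → ∀ A : Matrix (Fin n) (Fin n) ℝ, A.PosSemidef →
        (∀ i j, A i j ∈ I) → (A.map f).PosSemidef) :
    ∀ n : ℕ, 1 ≤ n → ∀ a : ℝ, 0 ≤ a → (a : EReal) < R → ∀ u : Fin n → ℝ,
        (∀ i j, a + u i * u j ∈ I) →
        (Matrix.of fun i j => f (a + u i * u j)).PosSemidef := by
  intro n hn a ha _ u hu
  refine hf n hn (Matrix.of fun i j => a + u i * u j) ?_ hu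
  rw [psd_iff]
  refine ⟨by ext i j; simp [mul_comm], fun v => ?_⟩
  have : ∑ i, ∑ j, v i * v j * (Matrix.of fun i j => a + u i * u j) i j
      = a * (∑ i, v i) ^ 2 + (∑ i, v i * u i) ^ 2 := by
    rw [sq, sq, Finset.sum_mul_sum, Finset.sum_mul_sum, Finset.mul_sum, ← Finset.sum_add_distrib]
    refine Finset.sum_congr rfl fun i _ => ?_
    rw [Finset.mul_sum, ← Finset.sum_add_distrib]
    refine Finset.sum_congr rfl fun j _ => ?_
    simp; ring
  rw [this]; positivity

/-- **Rank two, arbitrary dimension.** For `I = (0,R)` with `0 < R ≤ ∞` and `f : I → ℝ`,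
the following are equivalent: (1) `f[a·1 + uuᵀ]` is positive semidefinite for all `n`,
all `a ∈ [0,R)` and `u ∈ ℝⁿ` with `a + uᵢuⱼ ∈ I`; (2) `f[A]` is positive semidefinite for
all positive semidefinite `A` of any size with entries in `I`; (3) `f` is absolutely
monotonic on `I`. -/
theorem rank_two_arbitrary_dimension
    (R : EReal) (hR : 0 < R) (I : Set ℝ)
    (hI : I = {x : ℝ | 0 < x ∧ (x : EReal) < R}) (f : ℝ → ℝ) :
    ((∀ n : ℕ, 1 ≤ n → ∀ a : ℝ, 0 ≤ a → (a : EReal) < R → ∀ u : Fin n → ℝ,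
        (∀ i j, a + u i * u j ∈ I) →
        (Matrix.of fun i j => f (a + u i * u j)).PosSemidef) ↔
      AbsolutelyMonotonicOn f I) ∧
    ((∀ n : ℕ, 1 ≤ n → ∀ A : Matrix (Fin n) (Fin n) ℝ, A.PosSemidef →
        (∀ i j, A i j ∈ I) → (A.map f).PosSemidef) ↔
      AbsolutelyMonotonicOn f I) := by
  have hIo : IsOpen I := by
    rw [hI]
    exact (isOpen_Ioi (a := (0 : ℝ))).inter
      (isOpen_Iio.preimage continuous_coe_real_ereal)
  refine ⟨⟨one_three hI hIo, fun h => two_one (three_two hI hIo h)⟩,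
    ⟨fun h => one_three hI hIo (two_one h), three_two hI hIo⟩⟩
end
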